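/- arXiv:math/0103239 — 8 statements merged into one kernel-verified Lean document; each statement's English description precedes it below -/
import Mathlib

section
/- Let n be an odd positive integer, let d be an integer, and let q : ℝⁿ∖{0} → ℂ be a smooth function that is homogeneous of degree d (q(tξ) = t^d q(ξ) for all t > 0 and ξ ≠ 0) and has regular parity (q(−ξ) = (−1)^d q(ξ) for all ξ ≠ 0). Then there exists a unique tempered distribution u on ℝⁿ such that: (i) u agrees with q away from the origin, i.e. u(φ) = ∫_{ℝⁿ} q(ξ)φ(ξ) dξ for every Schwartz function φ whose closed support does not contain 0; (ii) u is homogeneous of degree d, i.e. u(ξ ↦ φ(tξ)) = t^{−n−d} u(φ) for every t > 0 and every Schwartz φ; and (iii) u has regular parity, i.e. u(ξ ↦ φ(−ξ)) = (−1)^d u(φ) for every Schwartz φ. -/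
open MeasureTheory
open scoped SchwartzMap ContDiff

namespace SchwartzMap

section Dilation

variable {E : Type*} [NormedAddCommGroup E] [NormedSpace ℝ E]

/-- The dilation `φ ↦ (x ↦ φ (a • x))` of Schwartz functions. -/
noncomputable def dilation (a : ℝˣ) : 𝓢(E, ℂ) →L[ℂ] 𝓢(E, ℂ) :=
  compCLMOfContinuousLinearEquiv ℂ (ContinuousLinearEquiv.smulLeft a)

@[simp]
theorem dilation_apply (a : ℝˣ) (φ : 𝓢(E, ℂ)) (x : E) : dilation a φ x = φ ((a : ℝ) • x) := rfl

theorem dilation_comm (a b : ℝˣ) (φ : 𝓢(E, ℂ)) :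
    dilation a (dilation b φ) = dilation b (dilation a φ) := by
  ext x
  simp [smul_smul, mul_comm]

theorem iteratedFDeriv_dilation (a : ℝˣ) (φ : 𝓢(E, ℂ)) (i : ℕ) (x : E) :
    iteratedFDeriv ℝ i (dilation a φ) x = (a : ℝ) ^ i • iteratedFDeriv ℝ i φ ((a : ℝ) • x) := by
  have h := ContinuousLinearMap.iteratedFDeriv_comp_right
    ((a : ℝ) • ContinuousLinearMap.id ℝ E) (φ.smooth ⊤) x (i := i) (mod_cast le_top)
  have e : (φ ∘ ((a : ℝ) • ContinuousLinearMap.id ℝ E)) = dilation a φ := by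
    ext y; simp
  rw [e] at h
  rw [h]
  ext v
  simpa using ContinuousMultilinearMap.map_smul_univ (iteratedFDeriv ℝ i φ ((a : ℝ) • x))
    (fun _ => (a : ℝ)) v

/-- All derivatives of order less than `N` vanish at the origin. -/
def VanishesToOrder (N : ℕ) (φ : 𝓢(E, ℂ)) : Prop :=
  ∀ j < N, iteratedFDeriv ℝ j φ 0 = 0

theorem norm_iteratedFDeriv_le_of_vanishesToOrder {N : ℕ} {φ : 𝓢(E, ℂ)}
    (hφ : VanishesToOrder N φ) {j : ℕ} (hj : j ≤ N) (x : E) :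
    ‖iteratedFDeriv ℝ j φ x‖ ≤ SchwartzMap.seminorm ℂ 0 N φ * ‖x‖ ^ (N - j) := by
  induction hj using Nat.decreasingInduction generalizing x with
  | self => simpa using norm_iteratedFDeriv_le_seminorm ℂ φ N x
  | of_succ j hj ih =>
    have hd : Differentiable ℝ (iteratedFDeriv ℝ j φ) :=
      (φ.smooth ⊤).differentiable_iteratedFDeriv (mod_cast ENat.natCast_lt_top j)
    have key := Convex.norm_image_sub_le_of_norm_fderiv_le (𝕜 := ℝ)
      (f := iteratedFDeriv ℝ j φ) (s := Metric.closedBall (0 : E) ‖x‖)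
      (C := SchwartzMap.seminorm ℂ 0 N φ * ‖x‖ ^ (N - (j + 1))) (x := 0) (y := x)
      (fun y _ => hd y)
      (fun y hy => by
        rw [norm_fderiv_iteratedFDeriv]
        refine (ih y).trans ?_
        gcongr
        simpa using hy)
      (convex_closedBall _ _) (by simp) (by simp)
    rw [hφ j hj, sub_zero, sub_zero] at key
    refine key.trans_eq ?_
    rw [mul_assoc, ← pow_succ]
    congr 2
    omega

theorem vanishesToOrder_of_notMem_tsupport {φ : 𝓢(E, ℂ)} (hφ : (0 : E) ∉ tsupport φ) (N : ℕ) :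
    VanishesToOrder N φ := fun _ _ =>
  image_eq_zero_of_notMem_tsupport fun h => hφ (tsupport_iteratedFDeriv_subset _ h)

end Dilation

section Cutoff

variable {E : Type*} [NormedAddCommGroup E] [NormedSpace ℝ E]

theorem exists_seminorm_cutoff_le (η : 𝓢(E, ℂ)) (hη : tsupport η ⊆ Metric.closedBall 0 1)
    {N : ℕ} {φ : 𝓢(E, ℂ)} (hφ : VanishesToOrder N φ) (k : ℕ) {l : ℕ} (hl : l < N) :
    ∃ C : ℝ, ∀ a : ℝˣ, 1 ≤ (a : ℝ) →
      SchwartzMap.seminorm ℂ k l (smulLeftCLM ℂ (dilation a η) φ) ≤ C * (a : ℝ)⁻¹ := by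
  set M : ℕ → ℝ := fun i => SchwartzMap.seminorm ℂ 0 i η
  set P : ℝ := SchwartzMap.seminorm ℂ 0 N φ
  have hM : ∀ i, 0 ≤ M i := fun i => apply_nonneg _ _
  have hP : 0 ≤ P := apply_nonneg _ _
  refine ⟨∑ i ∈ Finset.range (l + 1), (l.choose i : ℝ) * M i * P, fun a ha => ?_⟩
  have ha0 : 0 < (a : ℝ) := one_pos.trans_le ha
  have hS : 0 ≤ ∑ i ∈ Finset.range (l + 1), (l.choose i : ℝ) * M i * P :=
    Finset.sum_nonneg fun i _ => by have := hM i; positivity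
  refine seminorm_le_bound ℂ k l _ (mul_nonneg hS (inv_nonneg.2 ha0.le)) fun x => ?_
  rw [smulLeftCLM_apply (dilation a η).hasTemperateGrowth]
  have leib := norm_iteratedFDeriv_smul_le ((dilation a η).smooth ⊤) (φ.smooth ⊤) x (n := l)
    (mod_cast le_top)
  rw [Finset.sum_mul]
  by_cases hx : ‖x‖ ≤ (a : ℝ)⁻¹
  · have hx1 : ‖x‖ ≤ 1 := hx.trans (inv_le_one_of_one_le₀ ha)
    refine (mul_le_of_le_one_left (norm_nonneg _) (pow_le_one₀ (norm_nonneg x) hx1)).trans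
      (leib.trans (Finset.sum_le_sum fun i hi => ?_))
    have hi : i ≤ l := Finset.mem_range_succ_iff.1 hi
    have h1 : ‖iteratedFDeriv ℝ i (dilation a η) x‖ ≤ (a : ℝ) ^ i * M i := by
      rw [iteratedFDeriv_dilation, norm_smul, norm_pow, Real.norm_of_nonneg ha0.le]
      gcongr
      exact norm_iteratedFDeriv_le_seminorm ℂ η i _
    have h2 : ‖iteratedFDeriv ℝ (l - i) φ x‖ ≤ P * ((a : ℝ)⁻¹ ^ i * (a : ℝ)⁻¹) := by
      refine (norm_iteratedFDeriv_le_of_vanishesToOrder hφ (by omega) x).trans ?_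
      gcongr
      rw [← pow_succ]
      calc ‖x‖ ^ (N - (l - i)) ≤ (a : ℝ)⁻¹ ^ (N - (l - i)) := by gcongr
        _ ≤ (a : ℝ)⁻¹ ^ (i + 1) :=
          pow_le_pow_of_le_one (by positivity) (inv_le_one_of_one_le₀ ha) (by omega)
    have := hM i
    calc _ ≤ (l.choose i : ℝ) * ((a : ℝ) ^ i * M i) * (P * ((a : ℝ)⁻¹ ^ i * (a : ℝ)⁻¹)) := by
          gcongr
      _ = _ := by
          rw [inv_pow]
          field_simp
  · have h0 : ∀ i, iteratedFDeriv ℝ i (dilation a η) x = 0 := fun i => by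
      have : (a : ℝ) • x ∉ tsupport (iteratedFDeriv ℝ i η) := fun h => by
        have := hη (tsupport_iteratedFDeriv_subset i h)
        rw [mem_closedBall_zero_iff, norm_smul, Real.norm_of_nonneg ha0.le] at this
        exact hx ((le_inv_mul_iff₀ ha0).2 this |>.trans_eq (mul_one _))
      rw [iteratedFDeriv_dilation, image_eq_zero_of_notMem_tsupport this, smul_zero]
    have : ‖iteratedFDeriv ℝ l (fun y => dilation a η y • φ y) x‖ ≤ 0 :=
      leib.trans_eq (Finset.sum_eq_zero fun i _ => by simp [h0])
    rw [le_antisymm this (norm_nonneg _), mul_zero]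
    exact Finset.sum_nonneg fun i _ => by have := hM i; positivity

/-- A tempered distribution supported at the origin has finite order. -/
theorem exists_order_of_support_zero [FiniteDimensional ℝ E] (w : 𝓢(E, ℂ) →L[ℂ] ℂ)
    (hw : ∀ φ : 𝓢(E, ℂ), (0 : E) ∉ tsupport φ → w φ = 0) :
    ∃ N : ℕ, ∀ φ : 𝓢(E, ℂ), VanishesToOrder N φ → w φ = 0 := by
  obtain ⟨s, C, -, hC⟩ := Seminorm.bound_of_continuous (schwartz_withSeminorms ℂ E ℂ)
    ((normSeminorm ℂ ℂ).comp w.toLinearMap) (continuous_norm.comp w.continuous)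
  refine ⟨s.sup Prod.snd + 1, fun φ hφ => ?_⟩
  let b : ContDiffBump (0 : E) := ⟨1 / 2, 1, by norm_num, by norm_num⟩
  have hb : tsupport (fun x => (b x : ℂ)) ⊆ Metric.closedBall 0 1 := by
    rw [← b.tsupport_eq]
    exact closure_mono fun x hx => by simpa using hx
  have hbc : HasCompactSupport (fun x => (b x : ℂ)) :=
    HasCompactSupport.of_support_subset_isCompact (isCompact_closedBall (0 : E) 1)
      (subset_closure.trans hb)
  let η : 𝓢(E, ℂ) := hbc.toSchwartzMap (Complex.ofRealCLM.contDiff.comp b.contDiff)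
  have hη : ∀ x, η x = b x := fun x => rfl
  choose! D hD using fun (p : ℕ × ℕ) (hp : p ∈ s) =>
    exists_seminorm_cutoff_le η hb hφ p.1 (l := p.2) (Nat.lt_succ_of_le (Finset.le_sup hp))
  have bound : ∀ a : ℝˣ, 1 ≤ (a : ℝ) → ‖w φ‖ ≤ C * (∑ p ∈ s, |D p|) * (a : ℝ)⁻¹ := by
    intro a ha
    have ha0 : 0 < (a : ℝ) := one_pos.trans_le ha
    have heq : w φ = w (smulLeftCLM ℂ (dilation a η) φ) := by
      rw [← sub_eq_zero, ← map_sub]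
      refine hw _ (notMem_tsupport_iff_eventuallyEq.2 ?_)
      filter_upwards [Metric.closedBall_mem_nhds (0 : E) (show 0 < (a : ℝ)⁻¹ / 2 by positivity)]
        with x hx
      have : b ((a : ℝ) • x) = 1 := b.one_of_mem_closedBall (by
        rw [mem_closedBall_zero_iff] at hx ⊢
        rw [norm_smul, Real.norm_of_nonneg ha0.le]
        calc (a : ℝ) * ‖x‖ ≤ a * ((a : ℝ)⁻¹ / 2) := by gcongr
          _ = 1 / 2 := by field_simp)
      rw [sub_apply, smulLeftCLM_apply_apply (dilation a η).hasTemperateGrowth, dilation_apply,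
        hη, this]
      simp
    rw [heq]
    refine (hC _).trans ?_
    rw [mul_assoc]
    refine mul_le_mul_of_nonneg_left ?_ C.2
    refine Seminorm.finset_sup_apply_le (by positivity) fun p hp => (hD p hp a ha).trans ?_
    gcongr
    exact (le_abs_self _).trans
      (Finset.single_le_sum (f := fun p => |D p|) (fun _ _ => abs_nonneg _) hp)
  have lim : Filter.Tendsto (fun m : ℕ => C * (∑ p ∈ s, |D p|) * ((m : ℝ) + 1)⁻¹)
      Filter.atTop (nhds 0) := by
    simpa using (tendsto_one_div_add_atTop_nhds_zero_nat (𝕜 := ℝ)).const_mul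
      (C * (∑ p ∈ s, |D p|))
  refine norm_le_zero_iff.1 (ge_of_tendsto' lim fun m => ?_)
  exact bound (Units.mk0 ((m : ℝ) + 1) (by positivity)) (by simp)

end Cutoff

section JetKiller

variable {E : Type*} [NormedAddCommGroup E] [NormedSpace ℝ E]

theorem iteratedFDeriv_dilation_sub_zero (a : ℝˣ) (c : ℂ) (φ : 𝓢(E, ℂ)) (j : ℕ) :
    iteratedFDeriv ℝ j (dilation a φ - c • φ) 0 =
      (((a : ℝ) : ℂ) ^ j - c) • iteratedFDeriv ℝ j φ 0 := by
  change iteratedFDeriv ℝ j (⇑(dilation a φ) - ⇑(c • φ)) 0 = _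
  rw [iteratedFDeriv_sub_apply ((dilation a φ).smooth j).contDiffAt
    ((c • φ).smooth j).contDiffAt, iteratedFDeriv_dilation, smul_zero]
  change _ - iteratedFDeriv ℝ j (c • ⇑φ) 0 = _
  rw [iteratedFDeriv_const_smul_apply (φ.smooth j).contDiffAt]
  ext v
  simp [sub_mul]

theorem VanishesToOrder.dilation_sub {N : ℕ} {φ : 𝓢(E, ℂ)} (hφ : VanishesToOrder N φ)
    (a : ℝˣ) (c : ℂ) : VanishesToOrder N (dilation a φ - c • φ) := fun j hj => by
  rw [iteratedFDeriv_dilation_sub_zero, hφ j hj, smul_zero]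

theorem VanishesToOrder.dilation_sub_succ {N : ℕ} {φ : 𝓢(E, ℂ)} (hφ : VanishesToOrder N φ)
    (a : ℝˣ) : VanishesToOrder (N + 1) (dilation a φ - ((a : ℝ) : ℂ) ^ N • φ) := fun j hj => by
  rcases Nat.lt_succ_iff_lt_or_eq.1 hj with hj | rfl
  · exact hφ.dilation_sub a _ j hj
  · rw [iteratedFDeriv_dilation_sub_zero, sub_self, zero_smul]

/-- The composition of the operators `φ ↦ φ (a j • ·) - (a j) ^ j φ` for `j < N`; the `j`-th one
annihilates the derivative of order `j` at the origin. -/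
noncomputable def jetKiller (a : ℕ → ℝˣ) : ℕ → 𝓢(E, ℂ) →L[ℂ] 𝓢(E, ℂ)
  | 0 => ContinuousLinearMap.id ℂ _
  | N + 1 => (dilation (a N) - ((a N : ℝ) : ℂ) ^ N • ContinuousLinearMap.id ℂ _) ∘L jetKiller a N

theorem jetKiller_succ_apply (a : ℕ → ℝˣ) (N : ℕ) (φ : 𝓢(E, ℂ)) :
    jetKiller a (N + 1) φ =
      dilation (a N) (jetKiller a N φ) - ((a N : ℝ) : ℂ) ^ N • jetKiller a N φ := rfl

theorem vanishesToOrder_jetKiller (a : ℕ → ℝˣ) (N : ℕ) (φ : 𝓢(E, ℂ)) :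
    VanishesToOrder N (jetKiller a N φ) := by
  induction N with
  | zero => exact fun j hj => absurd hj (Nat.not_lt_zero j)
  | succ N ih => exact ih.dilation_sub_succ (a N)

theorem VanishesToOrder.jetKiller {M : ℕ} {φ : 𝓢(E, ℂ)} (hφ : VanishesToOrder M φ)
    (a : ℕ → ℝˣ) (N : ℕ) : VanishesToOrder M (jetKiller a N φ) := by
  induction N with
  | zero => exact hφ
  | succ N ih => exact ih.dilation_sub (a N) _

theorem jetKiller_dilation (a : ℕ → ℝˣ) (N : ℕ) (b : ℝˣ) (φ : 𝓢(E, ℂ)) :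
    jetKiller a N (dilation b φ) = dilation b (jetKiller a N φ) := by
  induction N with
  | zero => rfl
  | succ N ih => rw [jetKiller_succ_apply, jetKiller_succ_apply, ih, dilation_comm, map_sub, map_smul]

theorem apply_jetKiller {a : ℕ → ℝˣ} {μ : ℕ → ℂ} {M : ℕ} {I : 𝓢(E, ℂ) → ℂ}
    (hsub : ∀ φ ψ, VanishesToOrder M φ → VanishesToOrder M ψ → ∀ c : ℂ,
      I (φ - c • ψ) = I φ - c * I ψ)
    (hI : ∀ j φ, I (dilation (a j) φ) = μ j * I φ) {φ : 𝓢(E, ℂ)} (hφ : VanishesToOrder M φ)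
    (N : ℕ) :
    I (jetKiller a N φ) = (∏ j ∈ Finset.range N, (μ j - ((a j : ℝ) : ℂ) ^ j)) * I φ := by
  induction N with
  | zero => simp [jetKiller]
  | succ N ih =>
    have hN := hφ.jetKiller a N
    have hd : VanishesToOrder M (dilation (a N) (SchwartzMap.jetKiller a N φ)) := by
      simpa using hN.dilation_sub (a N) 0
    rw [jetKiller_succ_apply, hsub _ _ hd hN, hI, ih, Finset.prod_range_succ]
    ring

/-- The dilation `2`, replaced by the reflection `-1` in the single degree `j = m`. -/
noncomputable def testDilation (m : ℤ) (j : ℕ) : ℝˣ :=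
  if (j : ℤ) = m then -1 else Units.mk0 2 two_ne_zero

/-- The factor by which a functional with homogeneity exponent `m` and parity `(-1) ^ d` scales
under `testDilation m j`. -/
noncomputable def testFactor (m d : ℤ) (j : ℕ) : ℂ :=
  if (j : ℤ) = m then (-1) ^ d else 2 ^ m

theorem prod_testFactor_sub_ne_zero {m d : ℤ} (h : Odd (m + d)) (N : ℕ) :
    ∏ j ∈ Finset.range N, (testFactor m d j - ((testDilation m j : ℝ) : ℂ) ^ j) ≠ 0 := by
  refine Finset.prod_ne_zero_iff.2 fun j _ => sub_ne_zero.2 ?_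
  by_cases hj : (j : ℤ) = m
  · simp only [testFactor, testDilation, hj, if_true]
    rw [← zpow_natCast, hj]
    push_cast
    intro he
    rcases Int.even_or_odd d with hd | hd
    · have hm : Odd m := by
        rcases Int.even_or_odd m with hm | hm
        · exact absurd h (Int.not_odd_iff_even.2 (hm.add hd))
        · exact hm
      rw [hd.neg_one_zpow, hm.neg_one_zpow] at he
      norm_num at he
    · have hm : Even m := by
        rcases Int.even_or_odd m with hm | hm
        · exact hm
        · exact absurd h (Int.not_odd_iff_even.2 (hm.add_odd hd))
      rw [hd.neg_one_zpow, hm.neg_one_zpow] at he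
      norm_num at he
  · simp only [testFactor, testDilation, hj, if_false, Units.val_mk0]
    intro he
    have h2 : (2 : ℝ) ^ m = 2 ^ (j : ℤ) := by
      rw [zpow_natCast]
      apply Complex.ofReal_injective
      push_cast
      simpa using he
    exact hj (zpow_right_injective₀ two_pos (by norm_num) h2).symm

theorem apply_dilation_testDilation {m d : ℤ} {I : 𝓢(E, ℂ) → ℂ}
    (hhom : ∀ t : ℝˣ, 0 < (t : ℝ) → ∀ φ, I (dilation t φ) = ((t : ℝ) : ℂ) ^ m * I φ)
    (hpar : ∀ φ, I (dilation (-1) φ) = (-1) ^ d * I φ) (j : ℕ) (φ : 𝓢(E, ℂ)) :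
    I (dilation (testDilation m j) φ) = testFactor m d j * I φ := by
  by_cases hj : (j : ℤ) = m
  · simp only [testFactor, testDilation, hj, if_true, hpar]
  · simp only [testFactor, testDilation, hj, if_false]
    simpa using hhom (Units.mk0 2 two_ne_zero) two_pos φ

/-- There is no nonzero tempered distribution supported at the origin which is homogeneous with
integer exponent and has the parity opposite to that of the derivatives of the Dirac mass. -/
theorem eq_zero_of_support_zero [FiniteDimensional ℝ E] {m d : ℤ} (h : Odd (m + d))
    {w : 𝓢(E, ℂ) →L[ℂ] ℂ} (hw : ∀ φ : 𝓢(E, ℂ), (0 : E) ∉ tsupport φ → w φ = 0)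
    (hhom : ∀ t : ℝˣ, 0 < (t : ℝ) → ∀ φ, w (dilation t φ) = ((t : ℝ) : ℂ) ^ m * w φ)
    (hpar : ∀ φ, w (dilation (-1) φ) = (-1) ^ d * w φ) : w = 0 := by
  obtain ⟨N, hN⟩ := exists_order_of_support_zero w hw
  ext φ
  have := apply_jetKiller (M := 0) (I := w) (fun φ ψ _ _ c => by simp)
    (apply_dilation_testDilation hhom hpar) (φ := φ) (fun j hj => absurd hj (Nat.not_lt_zero j)) N
  rw [hN _ (vanishesToOrder_jetKiller _ N φ)] at this
  exact (mul_eq_zero.1 this.symm).resolve_left (prod_testFactor_sub_ne_zero h N)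

end JetKiller

section Homogeneous

open Module

variable {E : Type*} [NormedAddCommGroup E] [NormedSpace ℝ E]

theorem exists_norm_le_zpow_of_homogeneous [FiniteDimensional ℝ E] {q : E → ℂ} {d : ℤ}
    (hq : ContinuousOn q {0}ᶜ)
    (hhom : ∀ t : ℝ, 0 < t → ∀ x : E, x ≠ 0 → q (t • x) = (t : ℂ) ^ d * q x) :
    ∃ C : ℝ, 0 ≤ C ∧ ∀ x ≠ 0, ‖q x‖ ≤ C * ‖x‖ ^ d := by
  obtain ⟨C, hC⟩ := (isCompact_sphere (0 : E) 1).exists_bound_of_continuousOn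
    (hq.mono fun x hx => ne_zero_of_mem_unit_sphere ⟨x, hx⟩)
  refine ⟨|C|, abs_nonneg C, fun x hx => ?_⟩
  have hx0 : 0 < ‖x‖ := norm_pos_iff.2 hx
  have hy : ‖‖x‖⁻¹ • x‖ = 1 := by
    rw [norm_smul, norm_inv, norm_norm, inv_mul_cancel₀ hx0.ne']
  have := hhom ‖x‖ hx0 (‖x‖⁻¹ • x) (by rw [← norm_pos_iff, hy]; exact one_pos)
  rw [smul_inv_smul₀ hx0.ne'] at this
  rw [this, norm_mul, norm_zpow, Complex.norm_real, norm_norm, mul_comm]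
  gcongr
  exact (hC _ (by simpa using hy)).trans (le_abs_self C)

theorem norm_mul_le_of_vanishesToOrder {q : E → ℂ} {d : ℤ} {C : ℝ} (hC0 : 0 ≤ C)
    (hC : ∀ x ≠ 0, ‖q x‖ ≤ C * ‖x‖ ^ d) {N k r : ℕ} (hN : -d ≤ N) (hk : d + r ≤ k)
    {φ : 𝓢(E, ℂ)} (hφ : VanishesToOrder N φ) {x : E} (hx : x ≠ 0) :
    ‖q x * φ x‖ ≤ C * 2 ^ r * (SchwartzMap.seminorm ℂ 0 N φ + SchwartzMap.seminorm ℂ k 0 φ) *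
      ((1 + ‖x‖) ^ r)⁻¹ := by
  have hx0 : 0 < ‖x‖ := norm_pos_iff.2 hx
  have hp1 : 0 ≤ SchwartzMap.seminorm ℂ 0 N φ := apply_nonneg _ _
  have hp2 : 0 ≤ SchwartzMap.seminorm ℂ k 0 φ := apply_nonneg _ _
  have b1 : ‖φ x‖ ≤ SchwartzMap.seminorm ℂ 0 N φ * ‖x‖ ^ N := by
    simpa using norm_iteratedFDeriv_le_of_vanishesToOrder hφ (Nat.zero_le N) x
  have b2 : ‖x‖ ^ k * ‖φ x‖ ≤ SchwartzMap.seminorm ℂ k 0 φ := norm_pow_mul_le_seminorm ℂ φ k x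
  generalize SchwartzMap.seminorm ℂ 0 N φ = p1 at *
  generalize SchwartzMap.seminorm ℂ k 0 φ = p2 at *
  have main : ‖x‖ ^ d * ‖φ x‖ ≤ 2 ^ r * (p1 + p2) * ((1 + ‖x‖) ^ r)⁻¹ := by
    rw [le_mul_inv_iff₀ (by positivity)]
    rcases le_total ‖x‖ 1 with h1 | h1
    · have : ‖x‖ ^ d * ‖φ x‖ ≤ p1 := by
        calc ‖x‖ ^ d * ‖φ x‖ ≤ ‖x‖ ^ d * (p1 * ‖x‖ ^ N) := by gcongr
          _ = p1 * ‖x‖ ^ (d + N) := by rw [zpow_add₀ hx0.ne', zpow_natCast]; ring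
          _ ≤ p1 * 1 := by
            gcongr
            obtain ⟨e, he⟩ := Int.eq_ofNat_of_zero_le (show 0 ≤ d + N by omega)
            rw [he, zpow_natCast]
            exact pow_le_one₀ hx0.le h1
          _ = p1 := mul_one _
      calc ‖x‖ ^ d * ‖φ x‖ * (1 + ‖x‖) ^ r ≤ p1 * 2 ^ r := by
            gcongr
            linarith
        _ ≤ 2 ^ r * (p1 + p2) := by
          rw [mul_comm]
          gcongr
          linarith
    · have : ‖x‖ ^ d * ‖φ x‖ * ‖x‖ ^ r ≤ p2 := by
        calc ‖x‖ ^ d * ‖φ x‖ * ‖x‖ ^ r = ‖x‖ ^ (d + r) * ‖φ x‖ := by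
              rw [zpow_add₀ hx0.ne', zpow_natCast]; ring
          _ ≤ ‖x‖ ^ (k : ℤ) * ‖φ x‖ := by gcongr
          _ ≤ p2 := by rw [zpow_natCast]; exact b2
      calc ‖x‖ ^ d * ‖φ x‖ * (1 + ‖x‖) ^ r ≤ ‖x‖ ^ d * ‖φ x‖ * (2 * ‖x‖) ^ r := by
            gcongr
            linarith
        _ = 2 ^ r * (‖x‖ ^ d * ‖φ x‖ * ‖x‖ ^ r) := by rw [mul_pow]; ring
        _ ≤ 2 ^ r * (p1 + p2) := by
          gcongr
          linarith
  calc ‖q x * φ x‖ = ‖q x‖ * ‖φ x‖ := norm_mul _ _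
    _ ≤ C * ‖x‖ ^ d * ‖φ x‖ := by gcongr; exact hC x hx
    _ = C * (‖x‖ ^ d * ‖φ x‖) := mul_assoc _ _ _
    _ ≤ C * (2 ^ r * (p1 + p2) * ((1 + ‖x‖) ^ r)⁻¹) := by gcongr
    _ = _ := by ring

variable [MeasurableSpace E] [BorelSpace E] [FiniteDimensional ℝ E] [Nontrivial E]
  (ν : Measure E) [ν.IsAddHaarMeasure]

theorem integral_mul_dilation {q : E → ℂ} {a : ℝˣ} {c : ℂ} (hc : c ≠ 0)
    (hq : ∀ x : E, x ≠ 0 → q ((a : ℝ) • x) = c * q x) (φ : 𝓢(E, ℂ)) :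
    ∫ x, q x * dilation a φ x ∂ν =
      ((|((a : ℝ) ^ finrank ℝ E)⁻¹| : ℝ) : ℂ) * c⁻¹ * ∫ x, q x * φ x ∂ν := by
  have h := Measure.integral_comp_smul ν (fun x => q x * φ x) (a : ℝ)
  have e : ∫ x, q ((a : ℝ) • x) * φ ((a : ℝ) • x) ∂ν = ∫ x, c * (q x * dilation a φ x) ∂ν := by
    refine integral_congr_ae ?_
    filter_upwards [compl_mem_ae_iff.2 (measure_singleton (μ := ν) (0 : E))] with x hx
    rw [hq x hx, dilation_apply, mul_assoc]
  rw [e, integral_const_mul] at h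
  rw [eq_comm, mul_right_comm, mul_inv_eq_iff_eq_mul₀ hc, mul_comm _ c, h, Complex.real_smul]

theorem exists_bound_integral_of_vanishesToOrder {q : E → ℂ} {d : ℤ} (hq : ContinuousOn q {0}ᶜ)
    (hhom : ∀ t : ℝ, 0 < t → ∀ x : E, x ≠ 0 → q (t • x) = (t : ℂ) ^ d * q x)
    {N : ℕ} (hN : -d ≤ N) :
    ∃ (k : ℕ) (B : ℝ), ∀ φ : 𝓢(E, ℂ), VanishesToOrder N φ →
      Integrable (fun x => q x * φ x) ν ∧ ‖∫ x, q x * φ x ∂ν‖ ≤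
        B * (SchwartzMap.seminorm ℂ 0 N φ + SchwartzMap.seminorm ℂ k 0 φ) := by
  obtain ⟨C, hC0, hC⟩ := exists_norm_le_zpow_of_homogeneous hq hhom
  set r := finrank ℝ E + 1
  set k := (d + r).toNat
  have hint : Integrable (fun x : E => ((1 + ‖x‖) ^ r)⁻¹) ν := by
    have := integrable_one_add_norm (E := E) (μ := ν) (r := r) (by simp [r])
    refine this.congr (Filter.Eventually.of_forall fun x => ?_)
    simp only
    rw [Real.rpow_neg (by positivity), Real.rpow_natCast]
  have hqm : AEStronglyMeasurable q ν := by
    have := hq.aestronglyMeasurable (μ := ν) (measurableSet_singleton (0 : E)).compl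
    rwa [restrict_compl_singleton] at this
  refine ⟨k, C * 2 ^ r * ∫ x : E, ((1 + ‖x‖) ^ r)⁻¹ ∂ν, fun φ hφ => ?_⟩
  set K := SchwartzMap.seminorm ℂ 0 N φ + SchwartzMap.seminorm ℂ k 0 φ
  have hb : ∀ᵐ x ∂ν, ‖q x * φ x‖ ≤ C * 2 ^ r * K * ((1 + ‖x‖) ^ r)⁻¹ := by
    filter_upwards [compl_mem_ae_iff.2 (measure_singleton (μ := ν) (0 : E))] with x hx
    exact norm_mul_le_of_vanishesToOrder hC0 hC hN (Int.self_le_toNat _) hφ hx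
  have hbi := hint.const_mul (C * 2 ^ r * K)
  refine ⟨hbi.mono' (hqm.mul φ.continuous.aestronglyMeasurable) hb, ?_⟩
  refine (norm_integral_le_of_norm_le hbi hb).trans_eq ?_
  rw [integral_const_mul]
  ring

/-- Integration against a homogeneous function, after enough derivatives at the origin have been
removed from the test function to make the integral converge. -/
theorem exists_regularized_integral {q : E → ℂ} {d : ℤ} (hq : ContinuousOn q {0}ᶜ)
    (hhom : ∀ t : ℝ, 0 < t → ∀ x : E, x ≠ 0 → q (t • x) = (t : ℂ) ^ d * q x)
    {N : ℕ} (hN : -d ≤ N) (a : ℕ → ℝˣ) :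
    ∃ L : 𝓢(E, ℂ) →L[ℂ] ℂ, ∀ φ, L φ = ∫ x, q x * jetKiller a N φ x ∂ν := by
  obtain ⟨k, B, hB⟩ := exists_bound_integral_of_vanishesToOrder ν hq hhom hN
  have hv := vanishesToOrder_jetKiller (E := E) a N
  let L : 𝓢(E, ℂ) →ₗ[ℂ] ℂ :=
    { toFun := fun φ => ∫ x, q x * jetKiller a N φ x ∂ν
      map_add' := fun φ ψ => by
        rw [← integral_add (hB _ (hv φ)).1 (hB _ (hv ψ)).1]
        simp [mul_add]
      map_smul' := fun c φ => by
        rw [RingHom.id_apply, smul_eq_mul, ← integral_const_mul]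
        simp [mul_left_comm] }
  have hsem : ∀ i j, Continuous fun φ : 𝓢(E, ℂ) => SchwartzMap.seminorm ℂ i j (jetKiller a N φ) :=
    fun i j => ((schwartz_withSeminorms ℂ E ℂ).continuous_seminorm (i, j)).comp
      (jetKiller a N).continuous
  have hL : Continuous L := by
    refine continuous_of_continuousAt_zero L ?_
    rw [ContinuousAt, map_zero]
    refine squeeze_zero_norm (fun φ => (hB _ (hv φ)).2) ?_
    have := (((hsem 0 N).add (hsem k 0)).const_mul B).tendsto 0
    simpa using this
  exact ⟨⟨L, hL⟩, fun φ => rfl⟩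

/-- In odd dimension, a continuous homogeneous function of integer degree `d` and parity
`(-1) ^ d` on the complement of the origin extends to a homogeneous tempered distribution of the
same degree and parity. -/
theorem exists_homogeneous_extension {q : E → ℂ} {d : ℤ} (hodd : Odd (finrank ℝ E))
    (hq : ContinuousOn q {0}ᶜ)
    (hhom : ∀ t : ℝ, 0 < t → ∀ x : E, x ≠ 0 → q (t • x) = (t : ℂ) ^ d * q x)
    (hpar : ∀ x : E, x ≠ 0 → q (-x) = (-1) ^ d * q x) :
    ∃ u : 𝓢(E, ℂ) →L[ℂ] ℂ,
      (∀ φ : 𝓢(E, ℂ), (0 : E) ∉ tsupport φ → u φ = ∫ x, q x * φ x ∂ν) ∧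
      (∀ t : ℝˣ, 0 < (t : ℝ) → ∀ φ,
        u (dilation t φ) = ((t : ℝ) : ℂ) ^ (-(finrank ℝ E : ℤ) - d) * u φ) ∧
      (∀ φ, u (dilation (-1) φ) = (-1) ^ d * u φ) := by
  set m : ℤ := -(finrank ℝ E : ℤ) - d with hm
  set I : 𝓢(E, ℂ) → ℂ := fun φ => ∫ x, q x * φ x ∂ν
  have Ihom : ∀ t : ℝˣ, 0 < (t : ℝ) → ∀ φ, I (dilation t φ) = ((t : ℝ) : ℂ) ^ m * I φ := by
    intro t ht φ
    have ht' : ((t : ℝ) : ℂ) ≠ 0 := Complex.ofReal_ne_zero.2 ht.ne'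
    have h := integral_mul_dilation ν (zpow_ne_zero d ht') (hhom t ht) φ
    rw [abs_of_pos (by positivity), Complex.ofReal_inv, Complex.ofReal_pow] at h
    refine h.trans ?_
    rw [hm, zpow_sub₀ ht', zpow_neg, zpow_natCast, div_eq_mul_inv]
  have Ipar : ∀ φ, I (dilation (-1) φ) = (-1) ^ d * I φ := by
    intro φ
    have h := integral_mul_dilation ν (q := q) (a := -1) (c := (-1) ^ d)
      (zpow_ne_zero d (by norm_num)) (fun x hx => by simpa using hpar x hx) φ
    refine h.trans ?_
    have hs : ((-1 : ℂ) ^ d)⁻¹ = (-1) ^ d := by rw [← inv_zpow]; norm_num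
    rw [hs]
    simp [I]
  have hmd : Odd (m + d) := by
    rw [hm, sub_add_cancel]
    exact (by exact_mod_cast hodd : Odd (finrank ℝ E : ℤ)).neg
  set N : ℕ := (-d).toNat
  have hN : -d ≤ N := Int.self_le_toNat _
  set a := testDilation m
  set c : ℂ := ∏ j ∈ Finset.range N, (testFactor m d j - ((a j : ℝ) : ℂ) ^ j)
  have hc : c ≠ 0 := prod_testFactor_sub_ne_zero hmd N
  obtain ⟨L, hL⟩ := exists_regularized_integral ν hq hhom hN a
  have hL' : ∀ φ, L φ = I (jetKiller a N φ) := hL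
  obtain ⟨k, B, hB⟩ := exists_bound_integral_of_vanishesToOrder ν hq hhom hN
  refine ⟨c⁻¹ • L, fun φ hφ => ?_, fun t ht φ => ?_, fun φ => ?_⟩
  · have hsub : ∀ φ ψ, VanishesToOrder N φ → VanishesToOrder N ψ → ∀ b : ℂ,
        I (φ - b • ψ) = I φ - b * I ψ := fun φ ψ hφ hψ b => by
      simp only [I]
      rw [← integral_const_mul, ← integral_sub (hB φ hφ).1 ((hB ψ hψ).1.const_mul b)]
      refine integral_congr_ae (Filter.Eventually.of_forall fun x => ?_)
      simp
      ring
    have := apply_jetKiller hsub (apply_dilation_testDilation Ihom Ipar)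
      (vanishesToOrder_of_notMem_tsupport hφ N) N
    rw [smul_apply, hL', this, smul_eq_mul, inv_mul_cancel_left₀ hc]
  · simp only [smul_apply, hL', jetKiller_dilation, Ihom t ht, smul_eq_mul]
    ring
  · simp only [smul_apply, hL', jetKiller_dilation, Ipar, smul_eq_mul]
    ring

end Homogeneous

end SchwartzMap

theorem stmt_0 (n : ℕ) (hodd : Odd n) (hpos : 0 < n) (d : ℤ)
    (q : EuclideanSpace ℝ (Fin n) → ℂ)
    (hsmooth : ContDiffOn ℝ (⊤ : ℕ∞) q {(0 : EuclideanSpace ℝ (Fin n))}ᶜ)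
    (hhom : ∀ t : ℝ, 0 < t → ∀ ξ : EuclideanSpace ℝ (Fin n), ξ ≠ 0 →
      q (t • ξ) = (t : ℂ) ^ d * q ξ)
    (hpar : ∀ ξ : EuclideanSpace ℝ (Fin n), ξ ≠ 0 → q (-ξ) = (-1 : ℂ) ^ d * q ξ) :
    ∃! u : SchwartzMap (EuclideanSpace ℝ (Fin n)) ℂ →L[ℂ] ℂ,
      (∀ φ : SchwartzMap (EuclideanSpace ℝ (Fin n)) ℂ,
        (0 : EuclideanSpace ℝ (Fin n)) ∉ tsupport ⇑φ →
        u φ = ∫ ξ, q ξ * φ ξ) ∧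
      (∀ t : ℝ, 0 < t → ∀ φ ψ : SchwartzMap (EuclideanSpace ℝ (Fin n)) ℂ,
        (∀ ξ, ψ ξ = φ (t • ξ)) → u ψ = (t : ℂ) ^ (-(n : ℤ) - d) * u φ) ∧
      (∀ φ ψ : SchwartzMap (EuclideanSpace ℝ (Fin n)) ℂ,
        (∀ ξ, ψ ξ = φ (-ξ)) → u ψ = (-1 : ℂ) ^ d * u φ) := by
  have hF : Module.finrank ℝ (EuclideanSpace ℝ (Fin n)) = n := finrank_euclideanSpace_fin
  have : Nonempty (Fin n) := ⟨⟨0, hpos⟩⟩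
  refine existsUnique_of_exists_of_unique ?_ ?_
  · obtain ⟨u, hu, huhom, hupar⟩ := SchwartzMap.exists_homogeneous_extension volume
      (hF.symm ▸ hodd) hsmooth.continuousOn hhom hpar
    rw [hF] at huhom
    refine ⟨u, hu, fun t ht φ ψ h => ?_, fun φ ψ h => ?_⟩
    · refine Eq.trans ?_ (huhom (Units.mk0 t ht.ne') ht φ)
      congr 1
      ext ξ
      exact h ξ
    · rw [← hupar φ]
      congr 1
      ext ξ
      simp [h ξ]
  · rintro u v ⟨hu, huhom, hupar⟩ ⟨hv, hvhom, hvpar⟩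
    have hmd : Odd (-(n : ℤ) - d + d) := by
      rw [sub_add_cancel]
      exact (by exact_mod_cast hodd : Odd (n : ℤ)).neg
    refine sub_eq_zero.1 (SchwartzMap.eq_zero_of_support_zero hmd
      (fun φ hφ => ?_) (fun t ht φ => ?_) fun φ => ?_)
    · rw [sub_apply, hu φ hφ, hv φ hφ, sub_self]
    · rw [sub_apply, sub_apply,
        huhom t ht φ _ fun _ => rfl, hvhom t ht φ _ fun _ => rfl, mul_sub]
    · have h : ∀ ξ, SchwartzMap.dilation (-1) φ ξ = φ (-ξ) := fun ξ => by simp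
      rw [sub_apply, sub_apply,
        hupar φ _ h, hvpar φ _ h, mul_sub]
end

section
/- Let G be a polynomial with real coefficients satisfying G(−x) = G(x) for all x, and let ℓ ≥ 2 be an integer. Let U = {z ∈ ℂ : Re z < 1} ∖ {−1, −3, −5, …} (complex numbers of real part less than 1 that are not negative odd integers). Then there exists a function f analytic on U such that f(z) = Σ_{j ≥ 1, j ≠ ℓ} (G(j)/(j² − ℓ²)) · j^z for every z ∈ U with Re z < −deg G (the series converging absolutely there), and f(0) = G(0)/(2ℓ²) + G(ℓ)/(4ℓ²) − G′(ℓ)/(2ℓ), where G′ is the derivative of G. -/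
open Filter Topology Finset in
/-- The sum of the telescoping series `∑_{j ≥ 1, j ≠ ℓ} 1 / (j² - ℓ²) = 3 / (4 ℓ²)`. -/
theorem hasSum_inv_sq_sub_sq (ℓ : ℕ) (hℓ : 1 ≤ ℓ)
    (hs : Summable fun j : ℕ => if 1 ≤ j ∧ j ≠ ℓ then 1 / ((j : ℝ) ^ 2 - (ℓ : ℝ) ^ 2) else 0) :
    HasSum (fun j : ℕ => if 1 ≤ j ∧ j ≠ ℓ then 1 / ((j : ℝ) ^ 2 - (ℓ : ℝ) ^ 2) else 0)
      (3 / (4 * (ℓ : ℝ) ^ 2)) := by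
  have hl : (0 : ℝ) < ℓ := by exact_mod_cast hℓ
  set g : ℕ → ℝ := fun j => 1 / ((j : ℝ) - ℓ) with hg
  have telescope : ∀ N, ∑ j ∈ range N, (g j - g (j + 2 * ℓ)) =
      ∑ j ∈ range (2 * ℓ), g j - ∑ i ∈ range (2 * ℓ), g (N + i) := by
    intro N
    have h1 := sum_range_add g N (2 * ℓ)
    have h2 := sum_range_add g (2 * ℓ) N
    rw [add_comm (2 * ℓ) N] at h2
    simp only [sum_sub_distrib]
    simp only [add_comm (2 * ℓ)] at h2
    linarith
  have center : ∑ j ∈ range (2 * ℓ), g j = -1 / ℓ := by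
    obtain ⟨m, rfl⟩ : ∃ m, ℓ = m + 1 := ⟨ℓ - 1, by omega⟩
    have h := sum_range_reflect (fun i => g (i + 1)) (2 * m + 1)
    have h' : ∑ i ∈ range (2 * m + 1), g (2 * m + 1 - 1 - i + 1) =
        ∑ i ∈ range (2 * m + 1), -g (i + 1) := by
      refine sum_congr rfl fun i hi => ?_
      have hi' := mem_range.1 hi
      have hc : ((2 * m + 1 - 1 - i + 1 : ℕ) : ℝ) = 2 * m - i + 1 := by
        rw [show 2 * m + 1 - 1 - i + 1 = 2 * m - i + 1 by omega, Nat.cast_add,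
          Nat.cast_sub (by omega)]
        push_cast
        ring
      simp only [hg, hc]
      rw [← one_div_neg_eq_neg_one_div]
      congr 1
      push_cast
      ring
    rw [h', sum_neg_distrib] at h
    rw [show 2 * (m + 1) = (2 * m + 1) + 1 by ring, sum_range_succ']
    have h0 : ∑ i ∈ range (2 * m + 1), g (i + 1) = 0 := by linarith
    rw [h0]
    simp only [hg, Nat.cast_zero, zero_sub, zero_add]
    rw [one_div_neg_eq_neg_one_div, neg_div]
  have hterm : ∀ j : ℕ, (if 1 ≤ j ∧ j ≠ ℓ then 1 / ((j : ℝ) ^ 2 - (ℓ : ℝ) ^ 2) else 0) =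
      1 / (2 * ℓ) * (g j - g (j + 2 * ℓ)) + (if j = 0 then 1 / (ℓ : ℝ) ^ 2 else 0)
        + (if j = ℓ then 1 / (4 * (ℓ : ℝ) ^ 2) else 0) := by
    intro j
    simp only [hg]
    push_cast
    rcases Nat.eq_zero_or_pos j with rfl | hj
    · have : 0 ≠ ℓ := by omega
      simp only [nonpos_iff_eq_zero, one_ne_zero, false_and, if_false, if_true, this,
        Nat.cast_zero]
      rw [show (0 : ℝ) + 2 * ℓ - ℓ = ℓ by ring, zero_sub]
      field_simp
      ring
    · by_cases hjl : j = ℓ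
      · subst hjl
        have : j ≠ 0 := by omega
        simp only [ne_eq, not_true_eq_false, and_false, if_false, if_true, this, sub_self]
        rw [show (j : ℝ) + 2 * j - j = 2 * j by ring]
        field_simp
        ring
      · have hj0 : j ≠ 0 := by omega
        have h1 : (j : ℝ) - ℓ ≠ 0 := sub_ne_zero.2 (by exact_mod_cast hjl)
        have h2 : (j : ℝ) + ℓ ≠ 0 := by positivity
        rw [if_pos ⟨hj, hjl⟩, if_neg hj0, if_neg hjl,
          show (j : ℝ) + 2 * ℓ - ℓ = j + ℓ by ring,
          show (j : ℝ) ^ 2 - (ℓ : ℝ) ^ 2 = (j - ℓ) * (j + ℓ) by ring]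
        field_simp
        ring
  have g_tendsto : Tendsto g atTop (𝓝 0) := by
    simp only [hg, one_div]
    exact tendsto_inv_atTop_zero.comp
      (tendsto_atTop_add_const_right _ _ tendsto_natCast_atTop_atTop)
  have htail : Tendsto (fun N => ∑ i ∈ range (2 * ℓ), g (N + i)) atTop (𝓝 0) := by
    have := tendsto_finsetSum (range (2 * ℓ))
      (fun i _ => g_tendsto.comp (tendsto_add_atTop_nat i))
    simpa using this
  rw [hs.hasSum_iff_tendsto_nat]
  have key : Tendsto (fun N => 1 / (2 * (ℓ : ℝ)) *
      (-1 / ℓ - ∑ i ∈ range (2 * ℓ), g (N + i)) + 1 / (ℓ : ℝ) ^ 2 + 1 / (4 * (ℓ : ℝ) ^ 2))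
      atTop (𝓝 (1 / (2 * (ℓ : ℝ)) * (-1 / ℓ - 0) + 1 / (ℓ : ℝ) ^ 2 + 1 / (4 * (ℓ : ℝ) ^ 2))) :=
    (((htail.const_sub _).const_mul _).add_const _).add_const _
  have hval : 1 / (2 * (ℓ : ℝ)) * (-1 / ℓ - 0) + 1 / (ℓ : ℝ) ^ 2 + 1 / (4 * (ℓ : ℝ) ^ 2) =
      3 / (4 * (ℓ : ℝ) ^ 2) := by
    field_simp
    ring
  rw [hval] at key
  refine key.congr' ?_
  filter_upwards [eventually_gt_atTop ℓ] with N hN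
  simp only [hterm, sum_add_distrib, ← mul_sum, telescope, center]
  simp [hN, (by omega : 0 < N)]

/-- The denominators `j² - ℓ²` are comparable to `j²` away from `ℓ`. -/
theorem sq_le_mul_norm_sq_sub_sq {j ℓ : ℕ} (hℓ : 1 ≤ ℓ) (hj : j ≠ ℓ) :
    (j : ℝ) ^ 2 ≤ ((ℓ : ℝ) ^ 2 + 1) * ‖(j : ℂ) ^ 2 - (ℓ : ℂ) ^ 2‖ := by
  have hn : ‖(j : ℂ) ^ 2 - (ℓ : ℂ) ^ 2‖ = |(j : ℝ) ^ 2 - (ℓ : ℝ) ^ 2| := by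
    rw [← Real.norm_eq_abs, ← Complex.norm_real]
    push_cast
    rfl
  have hl : (1 : ℝ) ≤ ℓ := by exact_mod_cast hℓ
  rw [hn]
  rcases lt_or_gt_of_ne hj with h | h
  · have h' : (j : ℝ) + 1 ≤ ℓ := by exact_mod_cast h
    have hj0 : (0 : ℝ) ≤ j := j.cast_nonneg
    rw [abs_of_nonpos (by nlinarith)]
    have : 1 ≤ -((j : ℝ) ^ 2 - (ℓ : ℝ) ^ 2) := by nlinarith
    nlinarith
  · have h' : (ℓ : ℝ) + 1 ≤ j := by exact_mod_cast h
    rw [abs_of_nonneg (by nlinarith)]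
    have : 1 ≤ (j : ℝ) ^ 2 - (ℓ : ℝ) ^ 2 := by nlinarith
    nlinarith

theorem norm_exp_mul_log_natCast {j : ℕ} (hj : 1 ≤ j) (z : ℂ) :
    ‖Complex.exp (z * Real.log (j : ℝ))‖ = (j : ℝ) ^ z.re := by
  rw [Complex.norm_exp, Real.rpow_def_of_pos (by exact_mod_cast hj), mul_comm (Real.log _),
    Complex.re_mul_ofReal]

/-- A summable majorant for the terms `j ^ z / (j² - ℓ²)` on `re z ≤ c`. -/
theorem norm_exp_mul_log_div_le {ℓ : ℕ} (hℓ : 1 ≤ ℓ) {c : ℝ} {z : ℂ} (hz : z.re ≤ c) (j : ℕ) :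
    ‖if 1 ≤ j ∧ j ≠ ℓ then
        Complex.exp (z * Real.log (j : ℝ)) / ((j : ℂ) ^ 2 - (ℓ : ℂ) ^ 2) else 0‖ ≤
      ((ℓ : ℝ) ^ 2 + 1) * (j : ℝ) ^ (c - 2) := by
  split_ifs with h
  · obtain ⟨hj, hjl⟩ := h
    have hj1 : (1 : ℝ) ≤ j := by exact_mod_cast hj
    have hb := sq_le_mul_norm_sq_sub_sq hℓ hjl
    have hj2 : (0 : ℝ) < (j : ℝ) ^ 2 := by positivity
    have hd : 0 < ‖(j : ℂ) ^ 2 - (ℓ : ℂ) ^ 2‖ := by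
      by_contra! h0
      nlinarith [sq_nonneg (ℓ : ℝ)]
    rw [norm_div, norm_exp_mul_log_natCast hj, Real.rpow_sub (by linarith), Real.rpow_two,
      div_le_iff₀ hd, mul_div_assoc', div_mul_eq_mul_div, le_div_iff₀ hj2]
    have hr := Real.rpow_le_rpow_of_exponent_le hj1 hz
    have hp : 0 ≤ (j : ℝ) ^ c := by positivity
    calc (j : ℝ) ^ z.re * (j : ℝ) ^ 2 ≤
        (j : ℝ) ^ c * (((ℓ : ℝ) ^ 2 + 1) * ‖(j : ℂ) ^ 2 - (ℓ : ℂ) ^ 2‖) := by gcongr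
      _ = _ := by ring
  · simp only [norm_zero]
    positivity

theorem summable_mul_rpow_sub_two (a : ℝ) {c : ℝ} (hc : c < 1) :
    Summable fun j : ℕ => a * (j : ℝ) ^ (c - 2) :=
  (Real.summable_nat_rpow.2 (by linarith)).mul_left _

/-- The Dirichlet-type series `∑_{j ≠ ℓ} j ^ z / (j² - ℓ²)` is holomorphic on `re z < 1`. -/
theorem differentiableOn_tsum_exp_div {ℓ : ℕ} (hℓ : 1 ≤ ℓ) :
    DifferentiableOn ℂ (fun z => ∑' j : ℕ, if 1 ≤ j ∧ j ≠ ℓ then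
      Complex.exp (z * Real.log (j : ℝ)) / ((j : ℂ) ^ 2 - (ℓ : ℂ) ^ 2) else 0)
      {z | z.re < 1} := by
  intro z hz
  obtain ⟨c, hzc, hc⟩ := exists_between (show z.re < 1 from hz)
  have ho : IsOpen {w : ℂ | w.re < c} := isOpen_lt Complex.continuous_re continuous_const
  have hd := Complex.differentiableOn_tsum_of_summable_norm
    (F := fun (j : ℕ) (w : ℂ) => if 1 ≤ j ∧ j ≠ ℓ then
      Complex.exp (w * Real.log (j : ℝ)) / ((j : ℂ) ^ 2 - (ℓ : ℂ) ^ 2) else 0)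
    (summable_mul_rpow_sub_two ((ℓ : ℝ) ^ 2 + 1) hc) (fun j => by
      split_ifs
      · fun_prop
      · fun_prop) ho
    (fun j w hw => norm_exp_mul_log_div_le hℓ (le_of_lt hw) j)
  exact ((hd z hzc).differentiableAt (ho.mem_nhds hzc)).differentiableWithinAt

theorem hasSum_exp_mul_log_ne {ℓ : ℕ} (hℓ : 1 ≤ ℓ) {s : ℂ} (hs : s.re < -1) :
    HasSum (fun j : ℕ => if 1 ≤ j ∧ j ≠ ℓ then Complex.exp (s * Real.log (j : ℝ)) else 0)
      (riemannZeta (-s) - Complex.exp (s * Real.log (ℓ : ℝ))) := by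
  have hs' : 1 < (-s).re := by simpa using by linarith
  have h1 : HasSum (fun j : ℕ => 1 / (j : ℂ) ^ (-s)) (riemannZeta (-s)) := by
    rw [zeta_eq_tsum_one_div_nat_cpow hs']
    exact (Complex.summable_one_div_nat_cpow.2 hs').hasSum
  have h2 := h1.sub (hasSum_ite_eq ℓ (Complex.exp (s * Real.log (ℓ : ℝ))))
  refine h2.congr_fun ?_
  intro j
  have hs0 : s ≠ 0 := by
    rintro rfl
    norm_num at hs
  rcases Nat.eq_zero_or_pos j with rfl | hj
  · have : 0 ≠ ℓ := by omega
    simp [this, hs0]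
  · have hj0 : (j : ℂ) ≠ 0 := by exact_mod_cast hj.ne'
    have he : 1 / (j : ℂ) ^ (-s) = Complex.exp (s * Real.log (j : ℝ)) := by
      rw [Complex.cpow_neg, one_div, inv_inv, Complex.cpow_def_of_ne_zero hj0, mul_comm,
        Complex.natCast_log]
    rw [he]
    by_cases hjl : j = ℓ
    · simp [hjl]
    · simp [hjl, Nat.one_le_iff_ne_zero.1 hj]

open Polynomial in
/-- An even polynomial can be divided by `X² - a²` with constant remainder. -/
theorem exists_even_quotient (G : ℝ[X]) (hG : ∀ x : ℝ, G.eval (-x) = G.eval x) {a : ℝ}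
    (ha : a ≠ 0) : ∃ Q : ℝ[X], G = (X ^ 2 - C (a ^ 2)) * Q + C (G.eval a) ∧
      (∀ k, Odd k → Q.coeff k = 0) ∧ (∀ k, Q.coeff k ≠ 0 → k + 2 ≤ G.natDegree) := by
  have hfac : (X ^ 2 - C (a ^ 2) : ℝ[X]) = (X - C a) * (X - C (-a)) := by
    simp only [map_neg, map_pow]
    ring
  have hmonic : (X ^ 2 - C (a ^ 2) : ℝ[X]).Monic := monic_X_pow_sub_C _ two_ne_zero
  have hdvd : (X ^ 2 - C (a ^ 2) : ℝ[X]) ∣ G - C (G.eval a) := by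
    rw [hfac]
    refine IsCoprime.mul_dvd ?_ ?_ ?_
    · refine isCoprime_X_sub_C_of_isUnit_sub (isUnit_iff_ne_zero.2 ?_)
      intro h
      exact ha (by linarith)
    · rw [dvd_iff_isRoot]
      simp
    · rw [dvd_iff_isRoot]
      simp [hG]
  obtain ⟨Q, hQ⟩ := hdvd
  refine ⟨Q, by rw [← hQ]; ring, ?_, ?_⟩
  · have hGc : G.comp (-X) = G := by
      refine Polynomial.funext fun x => ?_
      simp [hG]
    have hQc : Q.comp (-X) = Q := by
      refine mul_left_cancel₀ hmonic.ne_zero ?_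
      have := congrArg (fun p : ℝ[X] => p.comp (-X)) hQ
      simp only [sub_comp, mul_comp, pow_comp, X_comp, C_comp, hGc, neg_sq] at this
      rw [← this, hQ]
    intro k hk
    have h := congrArg (fun p : ℝ[X] => p.coeff k) hQc
    rw [show (-X : ℝ[X]) = C (-1) * X by simp] at h
    simp only [comp_C_mul_X_coeff, hk.neg_one_pow] at h
    linarith
  · intro k hk
    have hQ0 : Q ≠ 0 := by
      rintro rfl
      simp at hk
    have h := congrArg natDegree hQ
    rw [natDegree_sub_C, hmonic.natDegree_mul' hQ0, natDegree_X_pow_sub_C] at h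
    have := le_natDegree_of_ne_zero hk
    omega

theorem stmt_2 (G : Polynomial ℝ) (hG : ∀ x : ℝ, G.eval (-x) = G.eval x)
    (ℓ : ℕ) (hℓ : 2 ≤ ℓ) :
    ∃ f : ℂ → ℂ,
      AnalyticOnNhd ℂ f
        {z : ℂ | z.re < 1 ∧ ¬∃ m : ℕ, z = -(2 * (m : ℂ) + 1)} ∧
      (∀ z ∈ {z : ℂ | z.re < 1 ∧ ¬∃ m : ℕ, z = -(2 * (m : ℂ) + 1)},
        z.re < -(G.natDegree : ℝ) →
        HasSum (fun j : ℕ =>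
          if 1 ≤ j ∧ j ≠ ℓ then
            ((G.eval (j : ℝ) : ℝ) : ℂ) / ((j : ℂ) ^ 2 - (ℓ : ℂ) ^ 2) *
              Complex.exp (z * Real.log (j : ℝ))
          else 0) (f z)) ∧
      f 0 = ((G.eval 0 / (2 * (ℓ : ℝ) ^ 2) + G.eval (ℓ : ℝ) / (4 * (ℓ : ℝ) ^ 2)
        - G.derivative.eval (ℓ : ℝ) / (2 * (ℓ : ℝ)) : ℝ) : ℂ) := by
  have hl1 : 1 ≤ ℓ := by omega
  have hl : (ℓ : ℝ) ≠ 0 := by positivity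
  obtain ⟨Q, hQ, hodd, hdeg⟩ := exists_even_quotient G hG hl
  let t : ℂ → ℕ → ℂ := fun z j => if 1 ≤ j ∧ j ≠ ℓ then
      Complex.exp (z * Real.log (j : ℝ)) / ((j : ℂ) ^ 2 - (ℓ : ℂ) ^ 2) else 0
  have ht : ∀ z : ℂ, z.re < 1 → Summable (t z) := fun z hz =>
    Summable.of_norm_bounded (summable_mul_rpow_sub_two _ hz)
      (norm_exp_mul_log_div_le hl1 le_rfl)
  refine ⟨fun z => ∑ k ∈ Finset.range (Q.natDegree + 1), (Q.coeff k : ℂ) *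
      (riemannZeta (-(z + k)) - Complex.exp ((z + k) * Real.log (ℓ : ℝ))) +
      ((G.eval (ℓ : ℝ) : ℝ) : ℂ) * ∑' j, t z j, ?_, ?_, ?_⟩
  · rintro z ⟨hz, hzm⟩
    have h2 : AnalyticAt ℂ (fun z => ∑' j, t z j) z :=
      (differentiableOn_tsum_exp_div hl1).analyticAt
        ((isOpen_lt Complex.continuous_re continuous_const).mem_nhds hz)
    have hreg : ∀ k : ℕ, Even k → AnalyticAt ℂ (fun z : ℂ => riemannZeta (-(z + k))) z := by
      rintro k ⟨m, rfl⟩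
      have hne : -(z + (m + m : ℕ)) ≠ 1 := by
        intro h
        refine hzm ⟨m, ?_⟩
        push_cast at h
        linear_combination -h
      have hz1 : AnalyticAt ℂ riemannZeta (-(z + (m + m : ℕ))) := by
        refine DifferentiableOn.analyticAt (s := {1}ᶜ) (fun w hw => ?_)
          (isOpen_compl_singleton.mem_nhds hne)
        exact (differentiableAt_riemannZeta hw).differentiableWithinAt
      exact hz1.comp_of_eq (by fun_prop) rfl
    refine AnalyticAt.add (Finset.analyticAt_fun_sum _ fun k _ => ?_) (analyticAt_const.mul h2)
    rcases Nat.even_or_odd k with hk | hk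
    · exact analyticAt_const.mul ((hreg k hk).sub (by fun_prop))
    · simp only [hodd k hk, Complex.ofReal_zero, zero_mul]
      exact analyticAt_const
  · rintro z ⟨hz, -⟩ hzd
    have h1 : HasSum (fun j : ℕ => ∑ k ∈ Finset.range (Q.natDegree + 1), (Q.coeff k : ℂ) *
        (if 1 ≤ j ∧ j ≠ ℓ then Complex.exp ((z + k) * Real.log (j : ℝ)) else 0))
        (∑ k ∈ Finset.range (Q.natDegree + 1), (Q.coeff k : ℂ) *
          (riemannZeta (-(z + k)) - Complex.exp ((z + k) * Real.log (ℓ : ℝ)))) := by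
      refine hasSum_sum fun k _ => ?_
      by_cases hk : Q.coeff k = 0
      · simp only [hk, Complex.ofReal_zero, zero_mul]
        exact hasSum_zero
      · refine (hasSum_exp_mul_log_ne hl1 ?_).mul_left _
        have : (k : ℝ) + 2 ≤ G.natDegree := by exact_mod_cast hdeg k hk
        simp only [Complex.add_re, Complex.natCast_re]
        linarith
    refine (h1.add ((ht z hz).hasSum.mul_left ((G.eval (ℓ : ℝ) : ℝ) : ℂ))).congr_fun ?_
    intro j
    by_cases hj : 1 ≤ j ∧ j ≠ ℓ
    · simp only [t, if_pos hj]
      have hjpos : (0 : ℝ) < j := by exact_mod_cast hj.1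
      have hd : (j : ℂ) ^ 2 - (ℓ : ℂ) ^ 2 ≠ 0 := by
        intro h
        have := sq_le_mul_norm_sq_sub_sq hl1 hj.2
        rw [h, norm_zero, mul_zero] at this
        nlinarith
      have hexp : ∀ k : ℕ, Complex.exp ((z + k) * Real.log (j : ℝ)) =
          (j : ℂ) ^ k * Complex.exp (z * Real.log (j : ℝ)) := by
        intro k
        rw [add_mul, Complex.exp_add, Complex.exp_nat_mul, ← Complex.ofReal_exp,
          Real.exp_log hjpos, mul_comm, Complex.ofReal_natCast]
      have hsum : ∑ k ∈ Finset.range (Q.natDegree + 1), (Q.coeff k : ℂ) *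
          Complex.exp ((z + k) * Real.log (j : ℝ)) =
          ((Q.eval (j : ℝ) : ℝ) : ℂ) * Complex.exp (z * Real.log (j : ℝ)) := by
        rw [Polynomial.eval_eq_sum_range]
        rw [Complex.ofReal_sum, Finset.sum_mul]
        exact Finset.sum_congr rfl fun k _ => by
          rw [hexp, Complex.ofReal_mul, Complex.ofReal_pow, Complex.ofReal_natCast]
          ring
      have hGj : ((G.eval (j : ℝ) : ℝ) : ℂ) =
          ((j : ℂ) ^ 2 - (ℓ : ℂ) ^ 2) * ((Q.eval (j : ℝ) : ℝ) : ℂ) + ((G.eval (ℓ : ℝ) : ℝ) : ℂ) := by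
        have := congrArg (Polynomial.eval (j : ℝ)) hQ
        simp only [Polynomial.eval_add, Polynomial.eval_mul, Polynomial.eval_sub,
          Polynomial.eval_pow, Polynomial.eval_X, Polynomial.eval_C] at this
        rw [this]
        push_cast
        ring
      rw [hsum, hGj]
      field_simp
    · simp [t, if_neg hj]
  · have ht0 : ∀ j, t 0 j =
        ((if 1 ≤ j ∧ j ≠ ℓ then 1 / ((j : ℝ) ^ 2 - (ℓ : ℝ) ^ 2) else 0 : ℝ) : ℂ) := by
      intro j
      by_cases hj : 1 ≤ j ∧ j ≠ ℓ
      · simp [t, hj]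
      · simp [t, if_neg hj]
    have hs0 : ∑' j, t 0 j = ((3 / (4 * (ℓ : ℝ) ^ 2) : ℝ) : ℂ) := by
      have h := ht 0 (by simp)
      simp only [funext ht0] at h ⊢
      exact (Complex.hasSum_ofReal.2
        (hasSum_inv_sq_sub_sq ℓ hl1 (Complex.summable_ofReal.1 h))).tsum_eq
    have hzeta : ∀ k : ℕ, (Q.coeff k : ℂ) * riemannZeta (-(0 + k)) =
        if k = 0 then -(Q.coeff 0 : ℂ) / 2 else 0 := by
      intro k
      rcases Nat.even_or_odd k with ⟨m, rfl⟩ | hk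
      · rcases m with _ | m
        · simp [riemannZeta_zero]
          ring
        · rw [if_neg (by omega), show -(0 + ((m + 1 + (m + 1) : ℕ) : ℂ)) = -2 * (m + 1) by
            push_cast; ring, riemannZeta_neg_two_mul_nat_add_one, mul_zero]
      · rw [hodd k hk, if_neg (by rintro rfl; simp at hk)]
        simp
    have hexp : ∀ k : ℕ, Complex.exp ((0 + k) * Real.log (ℓ : ℝ)) = ((ℓ : ℝ) ^ k : ℝ) := by
      intro k
      rw [zero_add, Complex.exp_nat_mul, ← Complex.ofReal_exp,
        Real.exp_log (by exact_mod_cast hl1), Complex.ofReal_pow]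
    have hQl : ∑ k ∈ Finset.range (Q.natDegree + 1), (Q.coeff k : ℂ) * ((ℓ : ℝ) ^ k : ℝ) =
        ((Q.eval (ℓ : ℝ) : ℝ) : ℂ) := by
      rw [Polynomial.eval_eq_sum_range]
      push_cast
      rfl
    have hG0 : G.eval 0 = -(ℓ : ℝ) ^ 2 * Q.coeff 0 + G.eval (ℓ : ℝ) := by
      have := congrArg (Polynomial.eval 0) hQ
      simpa [Polynomial.coeff_zero_eq_eval_zero] using this
    have hG' : G.derivative.eval (ℓ : ℝ) = 2 * ℓ * Q.eval (ℓ : ℝ) := by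
      have := congrArg (fun p => (Polynomial.derivative p).eval (ℓ : ℝ)) hQ
      rw [this]
      simp only [Polynomial.derivative_add, Polynomial.derivative_mul, Polynomial.derivative_sub,
        Polynomial.derivative_X_pow, Polynomial.derivative_C, Polynomial.eval_add,
        Polynomial.eval_mul, Polynomial.eval_sub, Polynomial.eval_pow, Polynomial.eval_X,
        Polynomial.eval_C, Polynomial.eval_zero]
      norm_num
    simp only [mul_sub, Finset.sum_sub_distrib, hzeta, hexp, hs0, hQl]
    rw [Finset.sum_ite_eq' , if_pos (by simp), hG', hG0]
    have hlc : (ℓ : ℂ) ≠ 0 := by exact_mod_cast hl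
    push_cast
    field_simp
    ring
end

section
/- Let c : ℤ → ℂ be a tempered sequence, i.e. there exist constants C and N with |c_k| ≤ C(1+|k|)^N for all k ∈ ℤ. Suppose that for every smooth compactly supported function φ : ℝ → ℂ with support contained in the open interval (0, 2π), one has Σ_{k∈ℤ} c_k ∫_0^{2π} φ(r) e^{−ikr} dr = 0 (the sum converges absolutely since the integrals decay rapidly in k). Then there exists a polynomial p with complex coefficients such that c_k = p(k) for every k ∈ ℤ. -/
open Real

open scoped FourierTransform

/-- A sequence `ℤ → ℂ` with some vanishing iterated forward difference is polynomial on `[a, ∞)`. -/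
lemma exists_polynomial_eval_eq_of_fwdDiff_iter_eq_zero_of_le {c : ℤ → ℂ} {M : ℕ}
    (hc : (fwdDiff 1)^[M] c = 0) (a : ℤ) :
    ∃ p : Polynomial ℂ, ∀ k : ℤ, a ≤ k → c k = p.eval (k : ℂ) := by
  have hz (k : ℕ) (hk : M ≤ k) : (fwdDiff 1)^[k] c = 0 := by
    obtain ⟨m, rfl⟩ := Nat.exists_eq_add_of_le' hk
    rw [Function.iterate_add_apply, hc]
    exact Function.iterate_fixed (fwdDiff_const (1 : ℤ) (0 : ℂ)) m
  refine ⟨∑ k ∈ Finset.range M, Polynomial.C ((fwdDiff 1)^[k] c a / (k.factorial : ℂ)) *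
    (descPochhammer ℂ k).comp (Polynomial.X - Polynomial.C (a : ℂ)), fun k hk ↦ ?_⟩
  obtain ⟨n, rfl⟩ := Int.le.dest hk
  have h1 := shift_eq_sum_fwdDiff_iter (1 : ℤ) c n a
  have h2 : ∑ k ∈ Finset.range (n + 1), n.choose k • (fwdDiff 1)^[k] c a =
      ∑ k ∈ Finset.range M, n.choose k • (fwdDiff 1)^[k] c a := by
    refine (Finset.sum_subset (Finset.range_mono (le_max_left (n + 1) M)) fun k _ hk ↦ ?_).trans
      (Finset.sum_subset (Finset.range_mono (le_max_right (n + 1) M)) fun k _ hk ↦ ?_).symm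
    · rw [Nat.choose_eq_zero_of_lt (by simpa using hk), zero_smul]
    · rw [hz k (by simpa using hk)]
      simp
  rw [h2] at h1
  simp only [nsmul_eq_mul, mul_one] at h1
  rw [h1, Polynomial.eval_finsetSum]
  refine Finset.sum_congr rfl fun k _ ↦ ?_
  have h3 : (k.factorial : ℂ) ≠ 0 := by exact_mod_cast k.factorial_ne_zero
  simp only [Polynomial.eval_mul, Polynomial.eval_C, Polynomial.eval_comp, Polynomial.eval_sub,
    Polynomial.eval_X, Int.cast_add, Int.cast_natCast, add_sub_cancel_left,
    descPochhammer_eval_eq_descFactorial, Nat.descFactorial_eq_factorial_mul_choose, Nat.cast_mul]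
  field_simp

/-- A sequence `ℤ → ℂ` with some vanishing iterated forward difference is polynomial. -/
lemma exists_polynomial_eval_eq_of_fwdDiff_iter_eq_zero {c : ℤ → ℂ} {M : ℕ}
    (hc : (fwdDiff 1)^[M] c = 0) : ∃ p : Polynomial ℂ, ∀ k : ℤ, c k = p.eval (k : ℂ) := by
  choose P hP using exists_polynomial_eval_eq_of_fwdDiff_iter_eq_zero_of_le hc
  refine ⟨P 0, fun k ↦ ?_⟩
  suffices h : P k = P 0 by rw [← h]; exact hP k k le_rfl
  refine Polynomial.eq_of_infinite_eval_eq _ _ (Set.Infinite.mono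
    (s := Set.image (fun n : ℤ ↦ (n : ℂ)) (Set.Ici (max k 0))) ?_
    ((Set.Ici_infinite _).image Int.cast_injective.injOn))
  rintro _ ⟨n, hn, rfl⟩
  simp only [Set.mem_Ici, max_le_iff] at hn
  exact (hP k n hn.1).symm.trans (hP 0 n hn.2)

/-- A smooth function supported in `[-1, 1]` with nonzero integral, together with its Fourier
transform, which decays rapidly. -/
lemma exists_contDiff_fourier_decay (n : ℕ) :
    ∃ (ρ G : ℝ → ℂ) (D : ℝ), ContDiff ℝ (⊤ : ℕ∞) ρ ∧ (∀ x, 1 < |x| → ρ x = 0) ∧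
      (∀ ξ, G ξ = ∫ x, ρ x * Complex.exp (-Complex.I * ξ * x)) ∧
      Continuous G ∧ G 0 ≠ 0 ∧ ∀ ξ, (1 + |ξ|) ^ n * ‖G ξ‖ ≤ D := by
  let b : ContDiffBump (0 : ℝ) := ⟨1 / 2, 1, by norm_num, by norm_num⟩
  let ρ : ℝ → ℂ := fun x ↦ (b x : ℂ)
  have hρ : ContDiff ℝ (⊤ : ℕ∞) ρ := Complex.ofRealCLM.contDiff.comp b.contDiff
  have hρc : HasCompactSupport ρ := b.hasCompactSupport.comp_left (g := Complex.ofReal) (by simp)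
  let S : SchwartzMap ℝ ℂ := 𝓕 (hρc.toSchwartzMap hρ)
  have hS (ξ : ℝ) : S (ξ / (2 * π)) = ∫ x, ρ x * Complex.exp (-Complex.I * ξ * x) := by
    change 𝓕 ρ (ξ / (2 * π)) = _
    rw [Real.fourier_real_eq_integral_exp_smul]
    congr 1 with x
    rw [smul_eq_mul, mul_comm]
    congr 2
    have : (π : ℂ) ≠ 0 := by exact_mod_cast pi_ne_zero
    push_cast
    field_simp
  refine ⟨ρ, fun ξ ↦ S (ξ / (2 * π)), (2 * π) ^ n * (2 ^ n * (Finset.Iic (n, 0)).sup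
    (fun m => SchwartzMap.seminorm ℝ m.1 m.2) S), hρ, ?_, hS, ?_, ?_, fun ξ ↦ ?_⟩
  · intro x hx
    simp only [ρ, Complex.ofReal_eq_zero]
    exact b.zero_of_le_dist (by simpa [b] using hx.le)
  · exact S.continuous.comp (by fun_prop)
  · refine (hS 0).trans_ne ?_
    simp only [Complex.ofReal_zero, mul_zero, zero_mul, Complex.exp_zero, mul_one, ρ]
    rw [integral_complex_ofReal, Complex.ofReal_ne_zero]
    exact b.integral_pos.ne'
  · have h := SchwartzMap.one_add_le_sup_seminorm_apply (𝕜 := ℝ) (m := (n, 0)) (k := n) (n := 0)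
      le_rfl le_rfl S (ξ / (2 * π))
    rw [norm_iteratedFDeriv_zero] at h
    have hπ : 1 ≤ 2 * π := by linarith [pi_gt_three]
    calc (1 + |ξ|) ^ n * ‖S (ξ / (2 * π))‖
        ≤ (2 * π * (1 + ‖ξ / (2 * π)‖)) ^ n * ‖S (ξ / (2 * π))‖ := by
          gcongr
          rw [norm_div, norm_eq_abs, norm_eq_abs, abs_of_pos (by positivity : 0 < 2 * π)]
          field_simp
          linarith
      _ = (2 * π) ^ n * ((1 + ‖ξ / (2 * π)‖) ^ n * ‖S (ξ / (2 * π))‖) := by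
          rw [mul_pow, mul_assoc]
      _ ≤ _ := by gcongr

lemma norm_exp_neg_I_mul_intCast_mul (k : ℤ) (θ : ℝ) :
    ‖Complex.exp (-Complex.I * k * θ)‖ = 1 := by
  rw [show -Complex.I * k * θ = ((-(k * θ) : ℝ) : ℂ) * Complex.I by push_cast; ring,
    Complex.norm_exp_ofReal_mul_I]

/-- Taking the forward difference of Fourier coefficients multiplies by `exp (I θ) - 1`. -/
lemma HasSum.fwdDiff_fourier {a : ℤ → ℂ} {θ : ℝ} {s : ℂ}
    (h : HasSum (fun k : ℤ ↦ a k * Complex.exp (-Complex.I * k * θ)) s) :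
    HasSum (fun k : ℤ ↦ fwdDiff 1 a k * Complex.exp (-Complex.I * k * θ))
      ((Complex.exp (Complex.I * θ) - 1) * s) := by
  have h1 := (((Equiv.addRight (1 : ℤ)).hasSum_iff.mpr h).mul_left
    (Complex.exp (Complex.I * θ))).sub h
  rw [sub_mul, one_mul]
  refine h1.congr_fun fun k ↦ ?_
  simp only [Function.comp_apply, Equiv.coe_addRight, fwdDiff, sub_mul]
  rw [mul_left_comm, ← Complex.exp_add]
  congr 3
  push_cast
  ring_nf

lemma HasSum.fwdDiff_iter_fourier {a : ℤ → ℂ} {θ : ℝ} {s : ℂ}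
    (h : HasSum (fun k : ℤ ↦ a k * Complex.exp (-Complex.I * k * θ)) s) (M : ℕ) :
    HasSum (fun k : ℤ ↦ (fwdDiff 1)^[M] a k * Complex.exp (-Complex.I * k * θ))
      ((Complex.exp (Complex.I * θ) - 1) ^ M * s) := by
  induction M with
  | zero => simpa using h
  | succ M ih =>
    rw [pow_succ', mul_assoc]
    simpa only [Function.iterate_succ_apply'] using ih.fwdDiff_fourier

lemma Summable.norm_fwdDiff_iter {a : ℤ → ℂ} (h : Summable fun k ↦ ‖a k‖) (M : ℕ) :
    Summable fun k ↦ ‖(fwdDiff 1)^[M] a k‖ := by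
  induction M with
  | zero => simpa using h
  | succ M ih =>
    simp only [Function.iterate_succ_apply']
    exact .of_nonneg_of_le (fun _ ↦ norm_nonneg _) (fun k ↦ norm_sub_le _ _)
      (((Equiv.addRight (1 : ℤ)).summable_iff.mpr ih).add ih)

lemma integral_exp_neg_I_mul_intCast_mul (k : ℤ) :
    ∫ θ in (0 : ℝ)..2 * π, Complex.exp (-Complex.I * k * θ) = if k = 0 then 2 * (π : ℂ) else 0 := by
  split_ifs with hk
  · simp [hk]
  · have hk' : -Complex.I * (k : ℂ) ≠ 0 := by simp [hk]
    rw [integral_exp_mul_complex hk']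
    have : Complex.exp (-Complex.I * k * (2 * π : ℝ)) = 1 := by
      rw [Complex.exp_eq_one_iff]
      exact ⟨-k, by push_cast; ring⟩
    rw [this]
    simp

/-- The Fourier coefficients of an absolutely convergent Fourier series are bounded by its
sup norm. -/
lemma norm_coeff_le_of_hasSum_fourier {b : ℤ → ℂ} (hb : Summable fun k ↦ ‖b k‖) {h : ℝ → ℂ}
    (hh : ∀ θ ∈ Set.Icc 0 (2 * π), HasSum (fun k : ℤ ↦ b k * Complex.exp (-Complex.I * k * θ)) (h θ))
    {B : ℝ} (hB : ∀ θ ∈ Set.Icc 0 (2 * π), ‖h θ‖ ≤ B) (j : ℤ) : ‖b j‖ ≤ B := by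
  have hu : Set.uIoc 0 (2 * π) ⊆ Set.Icc 0 (2 * π) := by
    rw [Set.uIoc_of_le (by positivity)]
    exact Set.Ioc_subset_Icc_self
  have key : HasSum (fun k : ℤ ↦ ∫ θ in (0 : ℝ)..2 * π,
        b k * Complex.exp (-Complex.I * k * θ) * Complex.exp (-Complex.I * (-j : ℤ) * θ))
      (∫ θ in (0 : ℝ)..2 * π, h θ * Complex.exp (-Complex.I * (-j : ℤ) * θ)) := by
    refine intervalIntegral.hasSum_integral_of_dominated_convergence (fun k _ ↦ ‖b k‖)
      (fun k ↦ Continuous.aestronglyMeasurable (by fun_prop)) (fun k ↦ .of_forall fun θ _ ↦ ?_)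
      (.of_forall fun _ _ ↦ hb) intervalIntegrable_const
      (.of_forall fun θ hθ ↦ (hh θ (hu hθ)).mul_right _)
    rw [norm_mul, norm_mul, norm_exp_neg_I_mul_intCast_mul, norm_exp_neg_I_mul_intCast_mul,
      mul_one, mul_one]
  have hterm (k : ℤ) : ∫ θ in (0 : ℝ)..2 * π,
      b k * Complex.exp (-Complex.I * k * θ) * Complex.exp (-Complex.I * (-j : ℤ) * θ) =
      if k = j then b j * (2 * π) else 0 := by
    simp_rw [mul_assoc (b k), ← Complex.exp_add, intervalIntegral.integral_const_mul]
    have (θ : ℝ) : -Complex.I * k * θ + -Complex.I * (-j : ℤ) * θ =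
        -Complex.I * ((k - j : ℤ) : ℂ) * θ := by push_cast; ring
    simp_rw [this, integral_exp_neg_I_mul_intCast_mul, sub_eq_zero]
    split_ifs with hkj <;> simp [hkj]
  simp_rw [hterm] at key
  have heq := key.unique (hasSum_ite_eq j (b j * (2 * π)))
  have hle := intervalIntegral.norm_integral_le_of_norm_le_const (a := 0) (b := 2 * π) (C := B)
    (f := fun θ : ℝ ↦ h θ * Complex.exp (-Complex.I * (-j : ℤ) * θ)) (fun θ hθ ↦ by
      rw [norm_mul, norm_exp_neg_I_mul_intCast_mul, mul_one]
      exact hB θ (hu hθ))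
  rw [heq, norm_mul, sub_zero, abs_of_pos two_pi_pos] at hle
  have hn : ‖(2 * π : ℂ)‖ = 2 * π := by
    rw [norm_mul, Complex.norm_real, norm_of_nonneg pi_pos.le, Complex.norm_two]
  rw [hn] at hle
  exact le_of_mul_le_mul_right hle two_pi_pos

lemma norm_exp_I_mul_sub_one_le_of_le_or_le {ε θ : ℝ} (hθ : θ ∈ Set.Icc 0 (2 * π))
    (h : θ ≤ ε ∨ 2 * π - ε ≤ θ) : ‖Complex.exp (Complex.I * θ) - 1‖ ≤ ε := by
  rcases h with h | h
  · refine norm_exp_I_mul_ofReal_sub_one_le.trans ?_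
    rwa [norm_of_nonneg hθ.1]
  · have : Complex.exp (Complex.I * θ) = Complex.exp (Complex.I * (θ - 2 * π : ℝ)) := by
      rw [← Complex.exp_periodic.sub_eq (Complex.I * θ)]
      congr 1
      push_cast
      ring
    rw [this]
    refine norm_exp_I_mul_ofReal_sub_one_le.trans ?_
    rw [norm_of_nonpos (by linarith [hθ.2])]
    linarith

lemma integral_rescaled_mul_exp {ρ G : ℝ → ℂ} (hρ : ∀ x, 1 < |x| → ρ x = 0)
    (hG : ∀ ξ, G ξ = ∫ x, ρ x * Complex.exp (-Complex.I * ξ * x)) {ε θ : ℝ} (hε : 0 < ε)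
    (h1 : ε < θ) (h2 : θ < 2 * π - ε) (k : ℤ) :
    ∫ r in (0 : ℝ)..2 * π, ρ ((r - θ) / ε) * Complex.exp (-Complex.I * (k : ℂ) * (r : ℂ)) =
      ε * (G (ε * k) * Complex.exp (-Complex.I * k * θ)) := by
  rw [intervalIntegral.integral_eq_integral_of_support_subset]
  · have e (r : ℝ) : ρ ((r - θ) / ε) * Complex.exp (-Complex.I * (k : ℂ) * (r : ℂ)) =
        (fun x : ℝ ↦ ρ x * Complex.exp (-Complex.I * (ε * k : ℝ) * x) *
          Complex.exp (-Complex.I * k * θ)) ((r - θ) / ε) := by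
      simp only [mul_assoc, ← Complex.exp_add]
      congr 2
      have : (ε : ℂ) ≠ 0 := by exact_mod_cast hε.ne'
      push_cast
      field_simp
      ring
    simp_rw [e]
    rw [MeasureTheory.integral_sub_right_eq_self (fun r : ℝ ↦
      (fun x : ℝ ↦ ρ x * Complex.exp (-Complex.I * (ε * k : ℝ) * x) *
          Complex.exp (-Complex.I * k * θ)) (r / ε)) θ, MeasureTheory.Measure.integral_comp_div
      (fun x : ℝ ↦ ρ x * Complex.exp (-Complex.I * (ε * k : ℝ) * x) *
        Complex.exp (-Complex.I * k * θ)),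
      MeasureTheory.integral_mul_const, ← hG, abs_of_pos hε, Complex.real_smul]
  · intro r hr
    have h : |(r - θ) / ε| ≤ 1 := by
      by_contra! h
      exact hr (by simp [hρ _ h])
    rw [abs_div, abs_of_pos hε, div_le_one hε, abs_le] at h
    constructor <;> linarith

theorem stmt_4 (c : ℤ → ℂ)
    (htemp : ∃ C : ℝ, ∃ N : ℕ, ∀ k : ℤ, ‖c k‖ ≤ C * (1 + |(k : ℝ)|) ^ N)
    (hvanish : ∀ φ : ℝ → ℂ, ContDiff ℝ (⊤ : ℕ∞) φ → HasCompactSupport φ →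
      tsupport φ ⊆ Set.Ioo 0 (2 * π) →
      HasSum (fun k : ℤ =>
        c k * ∫ r in (0 : ℝ)..(2 * π), φ r * Complex.exp (-Complex.I * (k : ℂ) * (r : ℂ))) 0) :
    ∃ p : Polynomial ℂ, ∀ k : ℤ, c k = p.eval (k : ℂ) := by
  obtain ⟨C, N, hC⟩ := htemp
  obtain ⟨ρ, G, D, hρ, hρ0, hG, hGc, hG0, hD⟩ := exists_contDiff_fourier_decay (N + 2)
  have hC0 : 0 ≤ C := by simpa using (norm_nonneg _).trans (hC 0)
  have hD0 : 0 ≤ D := le_trans (by positivity) (hD 0)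
  have hsum : Summable fun k : ℤ ↦ 1 / (1 + |(k : ℝ)|) ^ 2 := by
    refine .of_norm_bounded_eventually (g := fun k : ℤ ↦ 1 / (k : ℝ) ^ 2)
      (Real.summable_one_div_int_pow.mpr one_lt_two) ?_
    filter_upwards [(Set.finite_singleton (0 : ℤ)).compl_mem_cofinite] with k hk
    have hk : (k : ℝ) ≠ 0 := by exact_mod_cast hk
    rw [norm_of_nonneg (by positivity), ← sq_abs (k : ℝ)]
    have := abs_pos.mpr hk
    gcongr
    linarith
  refine exists_polynomial_eval_eq_of_fwdDiff_iter_eq_zero (M := N + 3) (funext fun j ↦ ?_)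
  let a : ℝ → ℤ → ℂ := fun ε k ↦ c k * G (ε * k)
  have ha {ε : ℝ} (hε : 0 < ε) (hε1 : ε ≤ 1) (k : ℤ) :
      ‖a ε k‖ ≤ C * D / ε ^ (N + 2) * (1 / (1 + |(k : ℝ)|) ^ 2) := by
    have h1 : ε * (1 + |(k : ℝ)|) ≤ 1 + |ε * k| := by
      rw [abs_mul, abs_of_pos hε]
      linarith
    have h2 : (ε * (1 + |(k : ℝ)|)) ^ (N + 2) * ‖G (ε * k)‖ ≤ D :=
      le_trans (by gcongr) (hD (ε * k))
    have h3 : ‖G (ε * k)‖ ≤ D / (ε * (1 + |(k : ℝ)|)) ^ (N + 2) := by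
      rw [le_div_iff₀ (by positivity), mul_comm]
      exact h2
    calc ‖a ε k‖ = ‖c k‖ * ‖G (ε * k)‖ := norm_mul _ _
      _ ≤ (C * (1 + |(k : ℝ)|) ^ N) * (D / (ε * (1 + |(k : ℝ)|)) ^ (N + 2)) := by
          gcongr
          exact hC k
      _ = _ := by
          rw [mul_pow, pow_add (1 + |(k : ℝ)|)]
          field_simp
  have has {ε : ℝ} (hε : 0 < ε) (hε1 : ε ≤ 1) : Summable fun k ↦ ‖a ε k‖ :=
    .of_nonneg_of_le (fun _ ↦ norm_nonneg _) (ha hε hε1) (hsum.mul_left _)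
  set T := ∑' k : ℤ, 1 / (1 + |(k : ℝ)|) ^ 2
  have hT0 : 0 ≤ T := tsum_nonneg fun _ ↦ by positivity
  have hbound {ε : ℝ} (hε : 0 < ε) (hε1 : ε ≤ 1) :
      ‖(fwdDiff 1)^[N + 3] (a ε) j‖ ≤ C * D * T * ε := by
    have hF (θ : ℝ) : HasSum (fun k : ℤ ↦ a ε k * Complex.exp (-Complex.I * k * θ))
        (∑' k : ℤ, a ε k * Complex.exp (-Complex.I * k * θ)) := by
      refine (Summable.of_norm ?_).hasSum
      simpa only [norm_mul, norm_exp_neg_I_mul_intCast_mul, mul_one] using has hε hε1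
    refine norm_coeff_le_of_hasSum_fourier ((has hε hε1).norm_fwdDiff_iter _)
      (fun θ _ ↦ (hF θ).fwdDiff_iter_fourier (N + 3)) (fun θ hθ ↦ ?_) j
    by_cases h : θ ≤ ε ∨ 2 * π - ε ≤ θ
    · have hFle : ‖∑' k : ℤ, a ε k * Complex.exp (-Complex.I * k * θ)‖ ≤
          C * D / ε ^ (N + 2) * T := by
        refine tsum_of_norm_bounded (hsum.hasSum.mul_left _) fun k ↦ ?_
        rw [norm_mul, norm_exp_neg_I_mul_intCast_mul, mul_one]
        exact ha hε hε1 k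
      rw [norm_mul, norm_pow]
      calc _ ≤ ε ^ (N + 3) * (C * D / ε ^ (N + 2) * T) := by
            gcongr
            exact norm_exp_I_mul_sub_one_le_of_le_or_le hθ h
        _ = C * D * T * ε := by
            field_simp
            ring
    · push Not at h
      have hsupp : Function.support (fun r ↦ ρ ((r - θ) / ε)) ⊆ Set.Icc (θ - ε) (θ + ε) := by
        intro r hr
        have h : |(r - θ) / ε| ≤ 1 := by
          by_contra! h
          exact hr (hρ0 _ h)
        rw [abs_div, abs_of_pos hε, div_le_one hε, abs_le] at h
        constructor <;> linarith
      have hv := hvanish (fun r ↦ ρ ((r - θ) / ε)) (hρ.comp (by fun_prop))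
        (.of_support_subset_isCompact isCompact_Icc hsupp)
        ((closure_minimal hsupp isClosed_Icc).trans fun r hr ↦
          ⟨by linarith [hr.1], by linarith [hr.2]⟩)
      simp_rw [integral_rescaled_mul_exp hρ0 hG hε h.1 h.2] at hv
      have hz : HasSum (fun k : ℤ ↦ a ε k * Complex.exp (-Complex.I * k * θ)) 0 := by
        have hε' : (ε : ℂ) ≠ 0 := by exact_mod_cast hε.ne'
        have := hv.mul_left (ε : ℂ)⁻¹
        rw [mul_zero] at this
        refine this.congr_fun fun k ↦ ?_
        simp only [a]
        field_simp
      rw [hz.tsum_eq, mul_zero, norm_zero]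
      positivity
  have hcont : Continuous fun ε : ℝ ↦ ‖(fwdDiff 1)^[N + 3] (a ε) j‖ := by
    simp only [fwdDiff_iter_eq_sum_shift, a]
    fun_prop
  have hle : ‖(fwdDiff 1)^[N + 3] (a 0) j‖ ≤ C * D * T * 0 := by
    refine le_of_tendsto_of_tendsto (b := nhdsWithin (0 : ℝ) (Set.Ioi 0))
      (hcont.tendsto 0 |>.mono_left nhdsWithin_le_nhds)
      ((by fun_prop : Continuous fun ε : ℝ ↦ C * D * T * ε).tendsto 0 |>.mono_left
        nhdsWithin_le_nhds) ?_
    filter_upwards [Ioc_mem_nhdsGT (zero_lt_one (α := ℝ))] with ε hε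
    exact hbound hε.1 hε.2
  have ha0 : a 0 = G 0 • c := by
    ext k
    simp [a, mul_comm]
  rw [mul_zero, norm_le_zero_iff, ha0, fwdDiff_iter_const_smul] at hle
  simpa [hG0] using hle
end

section
/- Let α : ℤ → ℂ be a tempered sequence (|α_k| ≤ C(1+|k|)^N for some constants C, N), and define h on the open unit disc of ℂ by h(z) = α_0 + Σ_{k=1}^∞ (α_k z^k + α_{−k} z̄^k). Let f : (0, 2π) → ℂ be a function and suppose that h(ρ e^{ir}) → f(r) as ρ → 1⁻, uniformly on compact subsets of r ∈ (0, 2π). Then for every smooth compactly supported function φ : ℝ → ℂ with support contained in (0, 2π), Σ_{k∈ℤ} α_k ∫_0^{2π} φ(r) e^{ikr} dr = ∫_0^{2π} f(r) φ(r) dr, the sum on the left converging absolutely. -/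
open Real

/-- A sequence of polynomial growth times the geometric sequence `ρ ^ |k|` is summable. -/
lemma summable_norm_mul_pow_natAbs {α : ℤ → ℂ} {C : ℝ} {N : ℕ}
    (hα : ∀ k : ℤ, ‖α k‖ ≤ C * (1 + |(k : ℝ)|) ^ N) {ρ : ℝ} (h0 : 0 < ρ) (h1 : ρ < 1) :
    Summable fun k : ℤ => ‖α k‖ * ρ ^ k.natAbs := by
  have hgeom : Summable fun n : ℕ => C * ρ⁻¹ * (((n + 1 : ℕ) : ℝ) ^ N * ρ ^ (n + 1)) :=
    ((summable_nat_add_iff 1).mpr (summable_pow_mul_geometric_of_norm_lt_one (R := ℝ) N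
      (by rwa [norm_of_nonneg h0.le]))).mul_left _
  have bound (k : ℤ) : ‖α k‖ * ρ ^ k.natAbs ≤
      C * ρ⁻¹ * (((k.natAbs + 1 : ℕ) : ℝ) ^ N * ρ ^ (k.natAbs + 1)) := by
    calc ‖α k‖ * ρ ^ k.natAbs ≤ C * (1 + |(k : ℝ)|) ^ N * ρ ^ k.natAbs := by
          gcongr
          exact hα k
      _ = _ := by
          rw [Nat.cast_add_one, Nat.cast_natAbs, Int.cast_abs]
          field_simp
          ring
  exact .of_nat_of_neg
    (hgeom.of_nonneg_of_le (fun n => by positivity) fun n => by simpa using bound n)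
    (hgeom.of_nonneg_of_le (fun n => by positivity) fun n => by simpa using bound (-n))

/-- The expansion of a harmonic function on a circle, rewritten as a series indexed by `ℤ`. -/
lemma hasSum_int_of_hasSum_nat {α : ℤ → ℂ} {ρ : ℝ} (h0 : 0 ≤ ρ)
    (hs : Summable fun k : ℤ => ‖α k‖ * ρ ^ k.natAbs) {w : ℂ} (r : ℝ)
    (hw : HasSum (fun k : ℕ =>
        α ((k : ℤ) + 1) * ((ρ : ℂ) * Complex.exp (Complex.I * r)) ^ (k + 1) +
        α (-(k : ℤ) - 1) * (starRingEnd ℂ ((ρ : ℂ) * Complex.exp (Complex.I * r))) ^ (k + 1))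
        (w - α 0)) :
    HasSum (fun k : ℤ => α k * (ρ : ℂ) ^ k.natAbs * Complex.exp (Complex.I * k * r)) w := by
  set g : ℤ → ℂ := fun k => α k * (ρ : ℂ) ^ k.natAbs * Complex.exp (Complex.I * k * r) with hg
  have hsum : Summable g := by
    refine .of_norm (hs.congr fun k => ?_)
    rw [hg, norm_mul, norm_mul, norm_pow, Complex.norm_of_nonneg h0,
      show Complex.I * k * r = ((k * r : ℝ) : ℂ) * Complex.I by push_cast; ring,
      Complex.norm_exp_ofReal_mul_I, mul_one]
  have hpos : Summable fun n : ℕ => g (n + 1) :=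
    hsum.comp_injective (i := fun n : ℕ => (n : ℤ) + 1) fun a b h => by simpa using h
  have hneg : Summable fun n : ℕ => g (-(n + 1)) :=
    hsum.comp_injective (i := fun n : ℕ => -((n : ℤ) + 1)) fun a b h => by simpa using h
  have htot := hpos.hasSum.of_add_one_of_neg_add_one hneg.hasSum
  have hadd : HasSum (fun n : ℕ => g (n + 1) + g (-(n + 1))) (w - α 0) := by
    refine hw.congr_fun fun n => ?_
    have e1 : ((n : ℤ) + 1).natAbs = n + 1 := by omega
    have e2 : (-((n : ℤ) + 1)).natAbs = n + 1 := by omega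
    have e3 : -(n : ℤ) - 1 = -((n : ℤ) + 1) := by ring
    simp only [hg, e1, e2, e3, map_mul, Complex.conj_ofReal, ← Complex.exp_conj, Complex.conj_I,
      mul_pow, ← Complex.exp_nat_mul]
    push_cast
    ring_nf
  have hg0 : g 0 = α 0 := by simp [hg]
  convert htot using 1
  linear_combination -(hpos.hasSum.add hneg.hasSum).unique hadd - hg0

/-- The Fourier coefficients of a test function supported in `(0, 2π)` decay rapidly. -/
lemma exists_fourier_integral_decay {φ : ℝ → ℂ} (hφ : ContDiff ℝ (⊤ : ℕ∞) φ)
    (hc : HasCompactSupport φ) (hsupp : tsupport φ ⊆ Set.Ioo 0 (2 * π)) (m : ℕ) :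
    ∃ M : ℝ, ∀ k : ℤ, (1 + |(k : ℝ)|) ^ m *
      ‖∫ r in (0 : ℝ)..(2 * π), φ r * Complex.exp (Complex.I * k * r)‖ ≤ M := by
  obtain ⟨S, hF⟩ : ∃ S : ℝ, ∀ x, (1 + ‖x‖) ^ m *
      ‖FourierTransform.fourier (hc.toSchwartzMap hφ) x‖ ≤ S :=
    ⟨_, fun x => by
      simpa using SchwartzMap.one_add_le_sup_seminorm_apply (𝕜 := ℝ) (m := (m, 0)) le_rfl le_rfl
        (FourierTransform.fourier (hc.toSchwartzMap hφ)) x⟩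
  refine ⟨(2 * π) ^ m * S, fun k => ?_⟩
  have key : ∫ r in (0 : ℝ)..(2 * π), φ r * Complex.exp (Complex.I * k * r) =
      FourierTransform.fourier (hc.toSchwartzMap hφ) (-k / (2 * π)) := by
    rw [SchwartzMap.fourier_coe, Real.fourier_real_eq_integral_exp_smul,
      intervalIntegral.integral_eq_integral_of_support_subset]
    · refine MeasureTheory.integral_congr_ae (.of_forall fun v => ?_)
      have : -2 * π * v * (-k / (2 * π)) = k * v := by field_simp
      simp only [this, smul_eq_mul]
      change φ v * _ = _ * φ v
      push_cast
      ring_nf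
    · refine fun x hx => Set.Ioo_subset_Ioc_self (hsupp (subset_tsupport _ ?_))
      exact left_ne_zero_of_mul hx
  have h1 : 1 + |(k : ℝ)| ≤ 2 * π * (1 + ‖-(k : ℝ) / (2 * π)‖) := by
    rw [norm_div, norm_neg, Real.norm_eq_abs, Real.norm_of_nonneg (by positivity), mul_add,
      mul_div_cancel₀ _ (by positivity)]
    linarith [pi_gt_three]
  rw [key]
  calc _ ≤ (2 * π * (1 + ‖-(k : ℝ) / (2 * π)‖)) ^ m * _ := by gcongr
    _ ≤ _ := by
      rw [mul_pow, mul_assoc]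
      gcongr
      exact hF (-k / (2 * π))

lemma summable_tempered_mul_of_decay {α c : ℤ → ℂ} {C M : ℝ} {N : ℕ}
    (hα : ∀ k : ℤ, ‖α k‖ ≤ C * (1 + |(k : ℝ)|) ^ N)
    (hc : ∀ k : ℤ, (1 + |(k : ℝ)|) ^ (N + 2) * ‖c k‖ ≤ M) :
    Summable fun k => ‖α k * c k‖ := by
  have hC : 0 ≤ C := by simpa using (norm_nonneg _).trans (hα 0)
  have bound (k : ℤ) : ‖α k * c k‖ ≤ C * M * (1 / ((k.natAbs + 1 : ℕ) : ℝ) ^ 2) := by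
    have e : ((k.natAbs + 1 : ℕ) : ℝ) = 1 + |(k : ℝ)| := by
      rw [Nat.cast_add_one, Nat.cast_natAbs, Int.cast_abs, add_comm]
    rw [e, mul_one_div, le_div_iff₀ (by positivity), norm_mul]
    calc ‖α k‖ * ‖c k‖ * (1 + |(k : ℝ)|) ^ 2
        ≤ C * (1 + |(k : ℝ)|) ^ N * ‖c k‖ * (1 + |(k : ℝ)|) ^ 2 := by
          gcongr
          exact hα k
      _ = C * ((1 + |(k : ℝ)|) ^ (N + 2) * ‖c k‖) := by ring
      _ ≤ C * M := by
          gcongr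
          exact hc k
  have hs : Summable fun n : ℕ => C * M * (1 / ((n + 1 : ℕ) : ℝ) ^ 2) :=
    ((summable_nat_add_iff 1).mpr (Real.summable_one_div_nat_pow.mpr one_lt_two)).mul_left _
  exact .of_nat_of_neg
    (hs.of_nonneg_of_le (fun n => norm_nonneg _) fun n => by simpa using bound n)
    (hs.of_nonneg_of_le (fun n => norm_nonneg _) fun n => by simpa using bound (-n))

/-- Multiplying by a continuous compactly supported function turns uniform convergence on the
support into uniform convergence everywhere. -/
lemma TendstoUniformlyOn.tendstoUniformly_mul_of_hasCompactSupport {ι X : Type*}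
    [TopologicalSpace X] {l : Filter ι} {u : ι → X → ℂ} {f φ : X → ℂ}
    (hu : TendstoUniformlyOn u f l (tsupport φ)) (hφ : Continuous φ) (hc : HasCompactSupport φ) :
    TendstoUniformly (fun i x => u i x * φ x) (fun x => f x * φ x) l := by
  obtain ⟨B, hB⟩ := hφ.bounded_above_of_compact_support hc
  rw [Metric.tendstoUniformly_iff]
  rw [Metric.tendstoUniformlyOn_iff] at hu
  intro ε hε
  have hB1 : 0 < |B| + 1 := by positivity
  filter_upwards [hu (ε / (|B| + 1)) (by positivity)] with i hi x
  by_cases hx : x ∈ tsupport φ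
  · have h1 := hi x hx
    rw [lt_div_iff₀ hB1] at h1
    rw [dist_eq_norm, ← sub_mul, norm_mul, ← dist_eq_norm]
    refine lt_of_le_of_lt ?_ h1
    gcongr
    linarith [hB x, le_abs_self B]
  · simpa [image_eq_zero_of_notMem_tsupport hx] using hε

theorem stmt_5 (α : ℤ → ℂ)
    (htemp : ∃ C : ℝ, ∃ N : ℕ, ∀ k : ℤ, ‖α k‖ ≤ C * (1 + |(k : ℝ)|) ^ N)
    (h : ℂ → ℂ)
    (hh : ∀ z : ℂ, ‖z‖ < 1 →
      HasSum (fun k : ℕ =>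
        α ((k : ℤ) + 1) * z ^ (k + 1) + α (-(k : ℤ) - 1) * (starRingEnd ℂ z) ^ (k + 1))
        (h z - α 0))
    (f : ℝ → ℂ)
    (hbdy : ∀ K : Set ℝ, K ⊆ Set.Ioo 0 (2 * π) → IsCompact K →
      TendstoUniformlyOn (fun ρ : ℝ => fun r : ℝ => h ((ρ : ℂ) * Complex.exp (Complex.I * (r : ℂ))))
        f (nhdsWithin 1 (Set.Iio 1)) K) :
    ∀ φ : ℝ → ℂ, ContDiff ℝ (⊤ : ℕ∞) φ → HasCompactSupport φ →
      tsupport φ ⊆ Set.Ioo 0 (2 * π) →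
      HasSum (fun k : ℤ =>
          α k * ∫ r in (0 : ℝ)..(2 * π), φ r * Complex.exp (Complex.I * (k : ℂ) * (r : ℂ)))
        (∫ r in (0 : ℝ)..(2 * π), f r * φ r) := by
  intro φ hφ hc hsupp
  obtain ⟨C, N, hα⟩ := htemp
  obtain ⟨M, hM⟩ := exists_fourier_integral_decay hφ hc hsupp (N + 2)
  set c : ℤ → ℂ := fun k => ∫ r in (0 : ℝ)..(2 * π), φ r * Complex.exp (Complex.I * k * r)
    with hcdef
  have hsum : Summable fun k => ‖α k * c k‖ := summable_tempered_mul_of_decay hα hM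
  have hφc : Continuous φ := hφ.continuous
  have hunif := (hbdy _ hsupp hc).tendstoUniformly_mul_of_hasCompactSupport hφc hc
  have hexp (k : ℤ) (r : ℝ) : ‖Complex.exp (Complex.I * k * r)‖ = 1 := by
    rw [show Complex.I * k * r = ((k * r : ℝ) : ℂ) * Complex.I by push_cast; ring,
      Complex.norm_exp_ofReal_mul_I]
  have hev : ∀ᶠ ρ : ℝ in nhdsWithin 1 (Set.Iio 1), 0 < ρ ∧ ρ < 1 :=
    Ioo_mem_nhdsLT one_pos
  have hseries {ρ : ℝ} (hρ : 0 < ρ ∧ ρ < 1) (r : ℝ) :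
      HasSum (fun k : ℤ => α k * (ρ : ℂ) ^ k.natAbs * Complex.exp (Complex.I * k * r))
        (h (ρ * Complex.exp (Complex.I * r))) := by
    refine hasSum_int_of_hasSum_nat hρ.1.le (summable_norm_mul_pow_natAbs hα hρ.1 hρ.2) r (hh _ ?_)
    rw [norm_mul, mul_comm Complex.I, Complex.norm_exp_ofReal_mul_I,
      Complex.norm_of_nonneg hρ.1.le, mul_one]
    exact hρ.2
  have hterm {ρ : ℝ} (hρ : 0 < ρ) (k : ℤ) (r : ℝ) :
      ‖α k * (ρ : ℂ) ^ k.natAbs * Complex.exp (Complex.I * k * r)‖ = ‖α k‖ * ρ ^ k.natAbs := by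
    rw [norm_mul, norm_mul, norm_pow, Complex.norm_of_nonneg hρ.le, hexp, mul_one]
  have hcont {ρ : ℝ} (hρ : 0 < ρ ∧ ρ < 1) :
      Continuous fun r : ℝ => h (ρ * Complex.exp (Complex.I * r)) * φ r := by
    simp_rw [← (hseries hρ _).tsum_eq]
    exact (continuous_tsum (fun k => by fun_prop) (summable_norm_mul_pow_natAbs hα hρ.1 hρ.2)
      fun k r => (hterm hρ.1 k r).le).mul hφc
  have hint {ρ : ℝ} (hρ : 0 < ρ ∧ ρ < 1) :
      HasSum (fun k => α k * (ρ : ℂ) ^ k.natAbs * c k)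
        (∫ r in (0 : ℝ)..(2 * π), h (ρ * Complex.exp (Complex.I * r)) * φ r) := by
    have hs := summable_norm_mul_pow_natAbs hα hρ.1 hρ.2
    have := intervalIntegral.hasSum_integral_of_dominated_convergence
      (μ := MeasureTheory.volume) (a := 0) (b := 2 * π)
      (F := fun (k : ℤ) (r : ℝ) =>
        α k * (ρ : ℂ) ^ k.natAbs * Complex.exp (Complex.I * k * r) * φ r)
      (fun k r => ‖α k‖ * ρ ^ k.natAbs * ‖φ r‖)
      (fun k => Continuous.aestronglyMeasurable (by fun_prop))
      (fun k => .of_forall fun r _ => by rw [norm_mul, hterm hρ.1])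
      (.of_forall fun r _ => hs.mul_right _)
      (by simp_rw [tsum_mul_right]; exact Continuous.intervalIntegrable (by fun_prop) _ _)
      (.of_forall fun r _ => (hseries hρ r).mul_right _)
    refine this.congr_fun fun k => ?_
    rw [hcdef, ← intervalIntegral.integral_const_mul]
    congr 1 with r
    ring
  have hleft := (hunif.tendstoUniformlyOn (s := Set.uIcc 0 (2 * π)))
    |>.tendsto_intervalIntegral_of_continuousOn (μ := MeasureTheory.volume)
      (hev.mono fun ρ hρ => (hcont hρ).continuousOn)
  have hright : Filter.Tendsto (fun ρ : ℝ => ∑' k, α k * (ρ : ℂ) ^ k.natAbs * c k)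
      (nhdsWithin 1 (Set.Iio 1)) (nhds (∑' k, α k * c k)) := by
    refine tendsto_tsum_of_dominated_convergence hsum (fun k => ?_) ?_
    · have : Continuous fun ρ : ℝ => α k * (ρ : ℂ) ^ k.natAbs * c k := by fun_prop
      simpa using (this.tendsto 1).mono_left nhdsWithin_le_nhds
    · filter_upwards [hev] with ρ hρ k
      rw [mul_right_comm, norm_mul, norm_pow, Complex.norm_of_nonneg hρ.1.le]
      exact mul_le_of_le_one_right (norm_nonneg _) (pow_le_one₀ hρ.1.le hρ.2.le)
  have heq := tendsto_nhds_unique hleft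
    (hright.congr' (hev.mono fun ρ hρ => (hint hρ).tsum_eq))
  rw [heq]
  exact hsum.of_norm.hasSum
end

section
/- Let n be an odd positive integer, let d be an integer, and let q : ℝⁿ∖{0} → ℂ be a smooth function that is homogeneous of degree d (q(tξ) = t^d q(ξ) for all t > 0 and ξ ≠ 0) and has regular parity (q(−ξ) = (−1)^d q(ξ) for all ξ ≠ 0). Let f : ℝⁿ → ℂ be a Schwartz function, and let Ω = {z ∈ ℂ : Re z > −n−d} ∪ {z ∈ ℂ : z is not an odd integer}. Then there exists a function F analytic on Ω such that F(z) = ∫_{ℝⁿ} q(ξ) |ξ|^z f(ξ) dξ for every z with Re z > −n−d (the integral converging absolutely there). In particular the analytic continuation is regular at z = 0. -/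
open MeasureTheory

open Set Filter Topology Asymptotics

section Mellin

variable {g g' : ℝ → ℂ} {w : ℂ} {b : ℝ}

theorem tendsto_cpow_mul_atTop_of_isBigO (hg : ∀ a : ℝ, g =O[atTop] (· ^ (-a))) (w : ℂ) :
    Tendsto (fun r : ℝ ↦ (r : ℂ) ^ w * g r) atTop (𝓝 0) := by
  have h1 : (fun r : ℝ ↦ (r : ℂ) ^ w) =O[atTop] fun r : ℝ ↦ r ^ w.re := by
    refine .of_bound 1 ?_
    filter_upwards [eventually_gt_atTop 0] with r hr
    rw [Complex.norm_cpow_eq_rpow_re_of_pos hr, one_mul, Real.norm_eq_abs,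
      abs_of_nonneg (by positivity)]
  refine ((h1.mul (hg (w.re + 1))).congr' .rfl ?_).trans_tendsto (tendsto_rpow_neg_atTop one_pos)
  filter_upwards [eventually_gt_atTop 0] with r hr
  rw [← Real.rpow_add hr]
  ring_nf

theorem tendsto_cpow_mul_nhdsGT_zero_of_isBigO (hb : g =O[𝓝[>] 0] (· ^ (-b))) (hw : b < w.re) :
    Tendsto (fun r : ℝ ↦ (r : ℂ) ^ w * g r) (𝓝[>] 0) (𝓝 0) := by
  have h1 : (fun r : ℝ ↦ (r : ℂ) ^ w) =O[𝓝[>] 0] fun r : ℝ ↦ r ^ w.re := by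
    refine .of_bound 1 ?_
    filter_upwards [self_mem_nhdsWithin] with r hr
    rw [Complex.norm_cpow_eq_rpow_re_of_pos hr, one_mul, Real.norm_eq_abs,
      abs_of_nonneg (Real.rpow_nonneg (le_of_lt hr) _)]
  have h2 : Tendsto (fun r : ℝ ↦ r ^ (w.re - b)) (𝓝[>] 0) (𝓝 0) := by
    have := (Real.continuousAt_rpow_const 0 (w.re - b) (.inr (by linarith))).tendsto
    rw [Real.zero_rpow (by linarith)] at this
    exact this.mono_left nhdsWithin_le_nhds
  refine ((h1.mul hb).congr' .rfl ?_).trans_tendsto h2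
  filter_upwards [self_mem_nhdsWithin] with r hr
  rw [← Real.rpow_add hr, sub_eq_add_neg]

theorem Continuous.isBigO_nhdsGT_zero_rpow (hg : Continuous g) :
    g =O[𝓝[>] 0] (· ^ (-(0 : ℝ)) : ℝ → ℝ) := by
  simpa using (hg.tendsto 0).isBigO_one ℝ |>.mono nhdsWithin_le_nhds

theorem HasDerivAt.isBigO_nhdsGT_zero_rpow {c : ℂ} (hg : HasDerivAt g c 0) (h0 : g 0 = 0) :
    g =O[𝓝[>] 0] (· ^ (-(-1 : ℝ)) : ℝ → ℝ) := by
  simpa [h0] using hg.isBigO_sub.mono nhdsWithin_le_nhds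

theorem mellin_eq_neg_mellin_deriv_div (hd : ∀ r, HasDerivAt g (g' r) r) (hc : Continuous g')
    (hg : ∀ a : ℝ, g =O[atTop] (· ^ (-a))) (hg' : ∀ a : ℝ, g' =O[atTop] (· ^ (-a)))
    (hb : g =O[𝓝[>] 0] (· ^ (-b))) (hbw : b < w.re) (hw : -1 < w.re) (hw0 : w ≠ 0) :
    mellin g w = -mellin g' (w + 1) / w := by
  have hgc : Continuous g := continuous_iff_continuousAt.2 fun r ↦ (hd r).continuousAt
  have h1 : MellinConvergent g w := mellinConvergent_of_isBigO_rpow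
    (hgc.locallyIntegrable.locallyIntegrableOn _) (hg (w.re + 1)) (by linarith) hb hbw
  have h2 : MellinConvergent g' (w + 1) := mellinConvergent_of_isBigO_rpow
    (hc.locallyIntegrable.locallyIntegrableOn _) (hg' (w.re + 2))
    (by simp only [Complex.add_re, Complex.one_re]; linarith)
    hc.isBigO_nhdsGT_zero_rpow (by simp only [Complex.add_re, Complex.one_re]; linarith)
  have hu : ∀ r ∈ Ioi (0 : ℝ), HasDerivAt (fun r : ℝ ↦ (r : ℂ) ^ w) (w * (r : ℂ) ^ (w - 1)) r :=
    fun r hr ↦ by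
      have := (hasDerivAt_id (r : ℂ)).cpow_const (c := w) (.inl (by simpa using hr))
      simpa using this.comp_ofReal
  have key := integral_Ioi_mul_deriv_eq_deriv_mul (a := (0 : ℝ)) hu (fun r _ ↦ hd r)
    (by simpa [MellinConvergent, Pi.mul_def] using h2)
    (by simpa [MellinConvergent, IntegrableOn, Pi.mul_def, mul_assoc] using h1.const_mul w)
    (tendsto_cpow_mul_nhdsGT_zero_of_isBigO hb hbw) (tendsto_cpow_mul_atTop_of_isBigO hg w)
  rw [eq_div_iff hw0]
  simp only [mul_assoc, integral_const_mul] at key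
  simp only [mellin, add_sub_cancel_right, smul_eq_mul, key]
  ring

end Mellin

section Continuation

variable {G : ℕ → ℝ → ℂ}

/-- The Mellin transform of `G 0`, integrated by parts `k` times, when `G (i + 1)` is the
derivative of `G i`. -/
noncomputable def mellinByParts (G : ℕ → ℝ → ℂ) (k : ℕ) (s : ℂ) : ℂ :=
  (-1) ^ k * mellin (G k) (s + k) / ∏ i ∈ Finset.range k, (s + i)

theorem mellinByParts_succ (hd : ∀ k r, HasDerivAt (G k) (G (k + 1) r) r)
    (hG : ∀ k (a : ℝ), G k =O[atTop] (· ^ (-a))) {k : ℕ} {s : ℂ} (hs : s ≠ -k)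
    (hk : -(k : ℝ) < s.re ∨ G k 0 = 0 ∧ -(k : ℝ) - 1 < s.re) :
    mellinByParts G (k + 1) s = mellinByParts G k s := by
  have hc : ∀ k, Continuous (G k) := fun k ↦
    continuous_iff_continuousAt.2 fun r ↦ (hd k r).continuousAt
  have hs' : s + k ≠ 0 := fun h ↦ hs (eq_neg_of_add_eq_zero_left h)
  have key : mellin (G k) (s + k) = -mellin (G (k + 1)) (s + k + 1) / (s + k) := by
    rcases hk with hk | ⟨h0, hk⟩
    · exact mellin_eq_neg_mellin_deriv_div (hd k) (hc _) (hG k) (hG _)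
        (hc k).isBigO_nhdsGT_zero_rpow (by simp; linarith) (by simp; linarith) hs'
    · exact mellin_eq_neg_mellin_deriv_div (hd k) (hc _) (hG k) (hG _)
        ((hd k 0).isBigO_nhdsGT_zero_rpow h0) (by simp; linarith) (by simp; linarith) hs'
  rw [mellinByParts, mellinByParts, key, Finset.prod_range_succ]
  push_cast
  rw [← add_assoc]
  field_simp
  ring

theorem mellinByParts_eq_of_le (hd : ∀ k r, HasDerivAt (G k) (G (k + 1) r) r)
    (hG : ∀ k (a : ℝ), G k =O[atTop] (· ^ (-a))) {k l : ℕ} (hkl : k ≤ l) {s : ℂ}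
    (hs : ∀ i < l, s ≠ -i)
    (hk : -(k : ℝ) < s.re ∨ G k 0 = 0 ∧ -(k : ℝ) - 1 < s.re) :
    mellinByParts G l s = mellinByParts G k s := by
  induction l, hkl using Nat.le_induction with
  | base => rfl
  | succ l hkl ih =>
    rw [← ih fun i hi ↦ hs i (by omega)]
    refine mellinByParts_succ hd hG (hs l l.lt_succ_self) ?_
    rcases hkl.eq_or_lt with rfl | h
    · exact hk
    · have : (k : ℝ) + 1 ≤ l := mod_cast h
      left
      rcases hk with hk | hk <;> linarith

/-- The half plane `-k - 1 < re s` without the points `0, -1, …, -(k - 1)`. -/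
def byPartsDomain (k : ℕ) : Set ℂ := {s | -(k : ℝ) - 1 < s.re ∧ ∀ i < k, s ≠ -(i : ℂ)}

theorem isOpen_byPartsDomain (k : ℕ) : IsOpen (byPartsDomain k) := by
  refine (isOpen_lt continuous_const Complex.continuous_re).inter ?_
  have : {s : ℂ | ∀ i < k, s ≠ -(i : ℂ)} = ⋂ i ∈ Finset.range k, {-(i : ℂ)}ᶜ := by
    ext; simp
  change IsOpen {s : ℂ | ∀ i < k, s ≠ -(i : ℂ)}
  rw [this]
  exact isOpen_biInter_finset fun i _ ↦ isOpen_compl_singleton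

theorem differentiableOn_mellinByParts (hd : ∀ k r, HasDerivAt (G k) (G (k + 1) r) r)
    (hG : ∀ k (a : ℝ), G k =O[atTop] (· ^ (-a))) {k : ℕ} (h0 : G k 0 = 0) :
    DifferentiableOn ℂ (mellinByParts G k) (byPartsDomain k) := by
  intro s hs
  have hc : Continuous (G k) := continuous_iff_continuousAt.2 fun r ↦ (hd k r).continuousAt
  have h1 : DifferentiableAt ℂ (mellin (G k)) (s + k) :=
    mellin_differentiableAt_of_isBigO_rpow (hc.locallyIntegrable.locallyIntegrableOn _)
      (hG k (s.re + k + 1)) (by simp) ((hd k 0).isBigO_nhdsGT_zero_rpow h0)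
      (by have := hs.1; simp; linarith)
  have h2 : DifferentiableAt ℂ (fun s : ℂ ↦ mellin (G k) (s + k)) s :=
    h1.comp (g := mellin (G k)) s (by fun_prop)
  refine ((h2.const_mul _).div (by fun_prop) ?_).differentiableWithinAt
  rw [Finset.prod_ne_zero_iff]
  exact fun i hi h ↦ hs.2 i (Finset.mem_range.1 hi) (eq_neg_of_add_eq_zero_left h)

theorem exists_analyticOnNhd_eq_mellin (hd : ∀ k r, HasDerivAt (G k) (G (k + 1) r) r)
    (hG : ∀ k (a : ℝ), G k =O[atTop] (· ^ (-a))) (d : ℤ)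
    (h0 : ∀ k : ℕ, Odd (d + k) → G k 0 = 0) :
    ∃ F : ℂ → ℂ, AnalyticOnNhd ℂ F {s | 0 < s.re ∨ ∀ k : ℕ, Even (d + k) → s ≠ -(k : ℂ)} ∧
      ∀ s : ℂ, 0 < s.re → F s = mellin (G 0) s := by
  classical
  let F : ℂ → ℂ := fun s ↦
    if h : ∃ k : ℕ, Odd (d + k) ∧ s ∈ byPartsDomain k then mellinByParts G h.choose s else 0
  have hF : ∀ k : ℕ, Odd (d + k) → EqOn F (mellinByParts G k) (byPartsDomain k) := by
    intro k hk s hs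
    have h : ∃ k : ℕ, Odd (d + k) ∧ s ∈ byPartsDomain k := ⟨k, hk, hs⟩
    obtain ⟨hl, hls⟩ := h.choose_spec
    simp only [F, dif_pos h]
    rcases le_total k h.choose with hkl | hkl
    · exact mellinByParts_eq_of_le hd hG hkl hls.2 (.inr ⟨h0 k hk, hs.1⟩)
    · exact (mellinByParts_eq_of_le hd hG hkl hs.2 (.inr ⟨h0 _ hl, hls.1⟩)).symm
  have hlarge : ∀ m : ℕ, ∃ k : ℕ, m ≤ k ∧ Odd (d + k) := by
    intro m
    rcases Int.even_or_odd (d + m) with h | h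
    · exact ⟨m + 1, by omega, by push_cast; rw [← add_assoc]; exact h.add_one⟩
    · exact ⟨m, le_rfl, h⟩
  have hmem : ∀ s : ℂ, (∀ i : ℕ, s ≠ -(i : ℂ)) → ∃ k : ℕ, Odd (d + k) ∧ s ∈ byPartsDomain k := by
    intro s hs
    obtain ⟨m, hm⟩ := exists_nat_gt (-s.re)
    obtain ⟨k, hmk, hk⟩ := hlarge m
    have : (m : ℝ) ≤ k := mod_cast hmk
    exact ⟨k, hk, by linarith, fun i _ ↦ hs i⟩
  have hpos : ∀ s : ℂ, 0 < s.re → ∀ i : ℕ, s ≠ -(i : ℂ) := by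
    rintro s hs i rfl
    have : (0 : ℝ) ≤ i := i.cast_nonneg
    simp at hs
    linarith
  refine ⟨F, fun s hs ↦ ?_, fun s hs ↦ ?_⟩
  · obtain ⟨k, hk, hsk⟩ : ∃ k : ℕ, Odd (d + k) ∧ s ∈ byPartsDomain k := by
      by_cases h : ∀ i : ℕ, s ≠ -(i : ℂ)
      · exact hmem s h
      · push Not at h
        obtain ⟨j, rfl⟩ := h
        rcases hs with hs | hs
        · exact absurd rfl (hpos _ hs j)
        · refine ⟨j, Int.not_even_iff_odd.1 fun h ↦ hs j h rfl, by simp, fun i hi h ↦ ?_⟩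
          rw [neg_inj, Nat.cast_inj] at h
          omega
    exact ((differentiableOn_mellinByParts hd hG (h0 k hk)).congr (hF k hk)).analyticAt
      ((isOpen_byPartsDomain k).mem_nhds hsk)
  · obtain ⟨k, hk, hsk⟩ := hmem s (hpos s hs)
    rw [hF k hk hsk, mellinByParts_eq_of_le hd hG (Nat.zero_le k) hsk.2 (.inl (by simpa using hs))]
    simp [mellinByParts]

end Continuation

section Spherical

open Metric

variable {E : Type*} [NormedAddCommGroup E] {q : E → ℂ}

theorem ContinuousOn.continuous_sphere_restrict (hq : ContinuousOn q {0}ᶜ) :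
    Continuous fun ω : sphere (0 : E) 1 ↦ q ω :=
  hq.comp_continuous continuous_subtype_val fun ω ↦ ne_zero_of_mem_unit_sphere ω

variable [NormedSpace ℝ E]

theorem norm_iteratedFDeriv_apply_sphere_le (f : E → ℂ) (k : ℕ) (x : E) (ω : sphere (0 : E) 1) :
    ‖iteratedFDeriv ℝ k f x (fun _ ↦ (ω : E))‖ ≤ ‖iteratedFDeriv ℝ k f x‖ := by
  simpa using (iteratedFDeriv ℝ k f x).le_opNorm fun _ ↦ (ω : E)

theorem continuous_sphericalIntegrand (hq : ContinuousOn q {0}ᶜ) (f : SchwartzMap E ℂ) (k : ℕ)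
    (r : ℝ) : Continuous fun ω : sphere (0 : E) 1 ↦
      q ω * iteratedFDeriv ℝ k f (r • (ω : E)) (fun _ ↦ (ω : E)) := by
  have h := (f.smooth k).continuous_iteratedFDeriv'
  have h' : Continuous fun ω : sphere (0 : E) 1 ↦ iteratedFDeriv ℝ k f (r • (ω : E)) :=
    h.comp (by fun_prop)
  exact hq.continuous_sphere_restrict.mul (h'.eval (by fun_prop))

variable [FiniteDimensional ℝ E]

theorem ContinuousOn.exists_norm_le_on_sphere (hq : ContinuousOn q {0}ᶜ) :
    ∃ C, 0 ≤ C ∧ ∀ ω : sphere (0 : E) 1, ‖q ω‖ ≤ C := by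
  obtain ⟨C, hC⟩ := (isCompact_sphere (0 : E) 1).exists_bound_of_continuousOn
    (hq.mono fun x hx ↦ ne_zero_of_mem_unit_sphere (⟨x, hx⟩ : sphere (0 : E) 1))
  exact ⟨max C 0, le_max_right _ _, fun ω ↦ (hC ω ω.2).trans (le_max_left _ _)⟩

variable [MeasurableSpace E] [BorelSpace E] (μ : Measure E) [μ.IsAddHaarMeasure]

theorem measurePreserving_neg_toSphere :
    MeasurePreserving (fun ω : sphere (0 : E) 1 ↦ -ω) μ.toSphere μ.toSphere := by
  have hm : Measurable (fun ω : sphere (0 : E) 1 ↦ -ω) := continuous_neg.measurable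
  refine ⟨hm, Measure.ext fun s hs ↦ ?_⟩
  rw [Measure.map_apply hm hs, Measure.toSphere_apply' _ (hm hs), Measure.toSphere_apply' _ hs,
    ← Measure.measure_neg μ]
  congr 2
  ext x
  simp only [Set.mem_neg, Set.mem_smul, mem_image, mem_preimage, Subtype.exists]
  constructor
  · rintro ⟨r, hr, _, ⟨y, hy, hys, rfl⟩, hx⟩
    exact ⟨r, hr, -y, ⟨-y, by simpa using hy, hys, rfl⟩, by simp [hx]⟩
  · rintro ⟨r, hr, _, ⟨y, hy, hys, rfl⟩, rfl⟩
    exact ⟨r, hr, -y, ⟨-y, by simpa using hy, by convert hys; simp, rfl⟩, by simp⟩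

/-- The `k`-th derivative at `r` of the spherical integral `∫ q ω * f (r • ω)`. -/
noncomputable def sphericalIntegral (q f : E → ℂ) (k : ℕ) (r : ℝ) : ℂ :=
  ∫ ω : sphere (0 : E) 1, q ω * iteratedFDeriv ℝ k f (r • (ω : E)) (fun _ ↦ (ω : E)) ∂μ.toSphere

theorem hasDerivAt_sphericalIntegral (hq : ContinuousOn q {0}ᶜ) (f : SchwartzMap E ℂ) (k : ℕ)
    (r : ℝ) : HasDerivAt (sphericalIntegral μ q f k) (sphericalIntegral μ q f (k + 1) r) r := by
  obtain ⟨C, hC0, hC⟩ := hq.exists_norm_le_on_sphere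
  obtain ⟨D, hD0, hD⟩ := f.decay 0 (k + 1)
  have hcont := continuous_sphericalIntegrand hq f
  refine (hasDerivAt_integral_of_dominated_loc_of_deriv_le (𝕜 := ℝ) (bound := fun _ ↦ C * D)
    (F' := fun r (ω : sphere (0 : E) 1) ↦
      q ω * iteratedFDeriv ℝ (k + 1) f (r • (ω : E)) (fun _ ↦ (ω : E)))
    univ_mem (.of_forall fun r ↦ (hcont k r).aestronglyMeasurable)
    ((hcont k r).integrable_of_hasCompactSupport (.of_compactSpace _))
    (hcont (k + 1) r).aestronglyMeasurable ?_ (integrable_const _) ?_).2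
  · refine .of_forall fun ω r _ ↦ ?_
    rw [norm_mul]
    refine mul_le_mul (hC ω) ?_ (norm_nonneg _) hC0
    exact (norm_iteratedFDeriv_apply_sphere_le _ _ _ _).trans (by simpa using hD (r • (ω : E)))
  · refine .of_forall fun ω r _ ↦ HasDerivAt.const_mul _ ?_
    have h1 : HasFDerivAt (iteratedFDeriv ℝ k f) (fderiv ℝ (iteratedFDeriv ℝ k f) (r • (ω : E)))
        (r • (ω : E)) :=
      ((f.smooth (k + 1)).differentiable_iteratedFDeriv (m := k)
        (mod_cast k.lt_succ_self) _).hasFDerivAt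
    have h2 : HasDerivAt (fun r : ℝ ↦ r • (ω : E)) (ω : E) r := by
      simpa using (hasDerivAt_id r).smul_const (ω : E)
    have h3 := h1.comp_hasDerivAt r h2
    exact (ContinuousMultilinearMap.apply ℝ (fun _ : Fin k ↦ E) ℂ
      (fun _ ↦ (ω : E))).hasFDerivAt.comp_hasDerivAt r h3

theorem sphericalIntegral_isBigO (hq : ContinuousOn q {0}ᶜ) (f : SchwartzMap E ℂ) (k : ℕ)
    (a : ℝ) : sphericalIntegral μ q f k =O[atTop] (· ^ (-a)) := by
  obtain ⟨C, hC0, hC⟩ := hq.exists_norm_le_on_sphere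
  obtain ⟨m, hm⟩ := exists_nat_ge a
  obtain ⟨D, hD0, hD⟩ := f.decay m k
  refine .of_bound (C * D * μ.toSphere.real univ) ?_
  filter_upwards [eventually_ge_atTop 1] with r hr
  have hr0 : 0 < r := by linarith
  have hle : ∀ ω : sphere (0 : E) 1,
      ‖q ω * iteratedFDeriv ℝ k f (r • (ω : E)) (fun _ ↦ (ω : E))‖ ≤ C * D * r ^ (-a) := by
    intro ω
    rw [norm_mul, mul_assoc]
    refine mul_le_mul (hC ω) ?_ (norm_nonneg _) hC0
    refine (norm_iteratedFDeriv_apply_sphere_le _ _ _ _).trans ?_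
    have h1 : r ^ m * ‖iteratedFDeriv ℝ k f (r • (ω : E))‖ ≤ D := by
      simpa [norm_smul, abs_of_pos hr0] using hD (r • (ω : E))
    have h2 : r ^ a ≤ r ^ m := by
      simpa using Real.rpow_le_rpow_of_exponent_le hr hm
    rw [Real.rpow_neg hr0.le, ← div_eq_mul_inv, le_div_iff₀ (by positivity), mul_comm]
    exact (mul_le_mul_of_nonneg_right h2 (norm_nonneg _)).trans h1
  refine (norm_integral_le_of_norm_le_const (.of_forall hle)).trans_eq ?_
  rw [Real.norm_of_nonneg (by positivity)]
  ring

theorem sphericalIntegral_zero_of_odd {d : ℤ}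
    (hpar : ∀ x : E, x ≠ 0 → q (-x) = (-1 : ℂ) ^ d * q x) (f : E → ℂ) {k : ℕ}
    (hk : Odd (d + k)) : sphericalIntegral μ q f k 0 = 0 := by
  have h := (measurePreserving_neg_toSphere μ).integral_comp
    (Homeomorph.neg (sphere (0 : E) 1)).measurableEmbedding
    fun ω : sphere (0 : E) 1 ↦ q ω * iteratedFDeriv ℝ k f ((0 : ℝ) • (ω : E)) (fun _ ↦ (ω : E))
  have h2 : ∀ ω : sphere (0 : E) 1,
      q (-ω : sphere (0 : E) 1) * iteratedFDeriv ℝ k f ((0 : ℝ) • ((-ω : sphere (0 : E) 1) : E))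
        (fun _ ↦ ((-ω : sphere (0 : E) 1) : E)) =
      -(q ω * iteratedFDeriv ℝ k f ((0 : ℝ) • (ω : E)) (fun _ ↦ (ω : E))) := by
    intro ω
    have h3 := (iteratedFDeriv ℝ k f 0).map_smul_univ (fun _ ↦ (-1 : ℝ)) (fun _ ↦ (ω : E))
    have h4 : (-1 : ℂ) ^ d * (-1) ^ k = -1 := by
      rw [← zpow_natCast, ← zpow_add₀ (by norm_num), hk.neg_one_zpow]
    simp only [neg_smul, one_smul, Finset.prod_const, Finset.card_univ, Fintype.card_fin] at h3
    rw [coe_neg_sphere, hpar _ (ne_zero_of_mem_unit_sphere ω), zero_smul, zero_smul, h3,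
      Complex.real_smul]
    push_cast
    linear_combination (q ω * iteratedFDeriv ℝ k f 0 (fun _ ↦ (ω : E))) * h4
  simp only [h2, integral_neg] at h
  exact self_eq_neg.1 h.symm

variable [Nontrivial E]

theorem integrable_homogeneous_mul_schwartz (hq : ContinuousOn q {0}ᶜ) {d : ℤ}
    (hhom : ∀ t : ℝ, 0 < t → ∀ x : E, x ≠ 0 → q (t • x) = (t : ℂ) ^ d * q x)
    (f : SchwartzMap E ℂ) {z : ℂ} (hz : 0 < Module.finrank ℝ E + d + z.re) :
    Integrable (fun x ↦ q x * Complex.exp (z * (Real.log ‖x‖ : ℂ)) * f x) μ := by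
  obtain ⟨C, hC0, hC⟩ := hq.exists_norm_le_on_sphere
  obtain ⟨m, hm⟩ := exists_nat_gt (Module.finrank ℝ E + d + z.re)
  obtain ⟨D₀, hD₀, h0⟩ := f.decay 0 0
  obtain ⟨D, hD, h1⟩ := f.decay m 0
  have hae : ∀ᵐ x ∂μ, x ≠ 0 := by simp [ae_iff]
  have hn : 0 < Module.finrank ℝ E := Module.finrank_pos
  have h_int : Integrable (fun x : E ↦
      C * (‖x‖ ^ (d + z.re) * min D₀ (D * ‖x‖ ^ (-(m : ℝ))))) μ := by
    refine Integrable.const_mul ?_ C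
    rw [integrable_fun_norm_addHaar μ (f := fun r ↦ r ^ (d + z.re) * min D₀ (D * r ^ (-(m : ℝ))))]
    have hmel := mellin_convergent_of_isBigO_scalar (a := m) (b := 0)
      (f := fun r : ℝ ↦ min D₀ (D * r ^ (-(m : ℝ)))) (s := Module.finrank ℝ E + d + z.re)
      (ContinuousOn.locallyIntegrableOn (continuousOn_const.inf (continuousOn_const.mul
        fun r hr ↦ (Real.continuousAt_rpow_const r _ (.inl (ne_of_gt hr))).continuousWithinAt))
        measurableSet_Ioi) ?_ hm ?_ hz
    · refine hmel.congr_fun (fun r hr ↦ ?_) measurableSet_Ioi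
      have hr' : (0 : ℝ) < r := hr
      dsimp only
      rw [smul_eq_mul, ← mul_assoc, ← Real.rpow_natCast, ← Real.rpow_add hr', Nat.cast_pred hn]
      ring_nf
    · refine .of_bound D ?_
      filter_upwards [eventually_gt_atTop 0] with r hr
      rw [Real.norm_of_nonneg (by positivity), Real.norm_of_nonneg (by positivity)]
      exact min_le_right _ _
    · refine .of_bound D₀ ?_
      filter_upwards [self_mem_nhdsWithin] with r hr
      have hr' : (0 : ℝ) < r := hr
      rw [Real.norm_of_nonneg (by positivity)]
      simp
  refine h_int.mono' ?_ ?_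
  · rw [← restrict_compl_singleton (μ := μ) 0]
    refine ContinuousOn.aestronglyMeasurable ?_ (measurableSet_singleton _).compl
    refine (hq.mul ?_).mul f.continuous.continuousOn
    refine Complex.continuous_exp.comp_continuousOn (continuousOn_const.mul
      (Complex.continuous_ofReal.comp_continuousOn (continuous_norm.continuousOn.log ?_)))
    exact fun x hx ↦ norm_ne_zero_iff.2 hx
  · filter_upwards [hae] with x hx
    have hx' : 0 < ‖x‖ := norm_pos_iff.2 hx
    have hq1 : ‖q x‖ ≤ C * ‖x‖ ^ (d : ℝ) := by
      have h2 := hhom ‖x‖ hx' (‖x‖⁻¹ • x) (by simp [hx])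
      rw [smul_inv_smul₀ hx'.ne'] at h2
      rw [h2, norm_mul, norm_zpow, Complex.norm_real, norm_norm, mul_comm, Real.rpow_intCast]
      gcongr
      exact hC ⟨‖x‖⁻¹ • x, by simp [norm_smul, hx]⟩
    have he : ‖Complex.exp (z * (Real.log ‖x‖ : ℂ))‖ = ‖x‖ ^ z.re := by
      rw [Complex.norm_exp, Complex.re_mul_ofReal, Real.rpow_def_of_pos hx', mul_comm]
    have hf : ‖f x‖ ≤ min D₀ (D * ‖x‖ ^ (-(m : ℝ))) := by
      refine le_min (by simpa using h0 x) ?_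
      rw [Real.rpow_neg hx'.le, Real.rpow_natCast, ← div_eq_mul_inv, le_div_iff₀ (by positivity),
        mul_comm]
      simpa using h1 x
    rw [norm_mul, norm_mul, he, Real.rpow_add hx', ← mul_assoc, ← mul_assoc]
    gcongr

theorem integral_homogeneous_mul_schwartz_eq_mellin (hq : ContinuousOn q {0}ᶜ) {d : ℤ}
    (hhom : ∀ t : ℝ, 0 < t → ∀ x : E, x ≠ 0 → q (t • x) = (t : ℂ) ^ d * q x)
    (f : SchwartzMap E ℂ) {z : ℂ} (hz : 0 < Module.finrank ℝ E + d + z.re) :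
    ∫ x, q x * Complex.exp (z * (Real.log ‖x‖ : ℂ)) * f x ∂μ =
      mellin (sphericalIntegral μ q f 0) (Module.finrank ℝ E + d + z) := by
  set h : E → ℂ := fun x ↦ q x * Complex.exp (z * (Real.log ‖x‖ : ℂ)) * f x with hh
  have hn : 0 < Module.finrank ℝ E := Module.finrank_pos
  have h_int : Integrable h μ := integrable_homogeneous_mul_schwartz μ hq hhom f hz
  have hmp := μ.measurePreserving_homeomorphUnitSphereProd
  have hemb := (homeomorphUnitSphereProd E).measurableEmbedding
  have hcomp : ∀ x : ({0}ᶜ : Set E), h x =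
      (fun p : sphere (0 : E) 1 × Ioi (0 : ℝ) ↦ h ((p.2 : ℝ) • (p.1 : E)))
        (homeomorphUnitSphereProd E x) := by
    intro x
    have : ‖(x : E)‖ ≠ 0 := norm_ne_zero_iff.2 x.2
    simp [smul_inv_smul₀ this]
  have hprod : Integrable (fun p : sphere (0 : E) 1 × Ioi (0 : ℝ) ↦ h ((p.2 : ℝ) • (p.1 : E)))
      (μ.toSphere.prod (.volumeIoiPow (Module.finrank ℝ E - 1))) := by
    rw [← hmp.integrable_comp_emb hemb]
    have : IntegrableOn h {0}ᶜ μ := h_int.integrableOn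
    rw [integrableOn_iff_comap_subtypeVal (measurableSet_singleton _).compl] at this
    exact this.congr (.of_forall hcomp)
  calc
    ∫ x, h x ∂μ = ∫ x : ({0}ᶜ : Set E), h x ∂(μ.comap (↑)) := by
      rw [integral_subtype_comap (measurableSet_singleton _).compl h, restrict_compl_singleton]
    _ = ∫ p : sphere (0 : E) 1 × Ioi (0 : ℝ), h ((p.2 : ℝ) • (p.1 : E))
          ∂μ.toSphere.prod (.volumeIoiPow (Module.finrank ℝ E - 1)) := by
      rw [← hmp.integral_comp hemb]
      exact integral_congr_ae (.of_forall hcomp)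
    _ = ∫ r : Ioi (0 : ℝ), ∫ ω : sphere (0 : E) 1, h ((r : ℝ) • (ω : E)) ∂μ.toSphere
          ∂.volumeIoiPow (Module.finrank ℝ E - 1) := integral_prod_symm _ hprod
    _ = ∫ r : Ioi (0 : ℝ), (r : ℂ) ^ (d + z) * sphericalIntegral μ q f 0 r
          ∂.volumeIoiPow (Module.finrank ℝ E - 1) := by
      congr 1 with r
      have hr : (0 : ℝ) < r := r.2
      have hr' : ((r : ℝ) : ℂ) ≠ 0 := mod_cast hr.ne'
      rw [sphericalIntegral, ← integral_const_mul]
      congr 1 with ω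
      simp only [hh, hhom r hr _ (ne_zero_of_mem_unit_sphere ω), norm_smul, norm_eq_of_mem_sphere,
        mul_one, Real.norm_of_nonneg hr.le, iteratedFDeriv_zero_apply]
      rw [Complex.cpow_add _ _ hr', Complex.cpow_intCast, Complex.cpow_def_of_ne_zero hr' z,
        Complex.ofReal_log hr.le, mul_comm z]
      ring
    _ = _ := by
      simp only [Measure.volumeIoiPow, ENNReal.ofReal]
      rw [integral_withDensity_eq_integral_smul, mellin,
        integral_subtype_comap measurableSet_Ioi fun r : ℝ ↦
          Real.toNNReal (r ^ (Module.finrank ℝ E - 1)) •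
            ((r : ℂ) ^ (d + z) * sphericalIntegral μ q f 0 r),
        setIntegral_congr_fun measurableSet_Ioi fun r hr ↦ ?_]
      · have hr0 : (0 : ℝ) < r := hr
        have hr' : (r : ℂ) ≠ 0 := mod_cast hr0.ne'
        rw [NNReal.smul_def, Real.coe_toNNReal _ (by positivity), Complex.real_smul, smul_eq_mul,
          ← mul_assoc, Complex.ofReal_pow, ← Complex.cpow_natCast, ← Complex.cpow_add _ _ hr',
          Nat.cast_pred hn]
        ring_nf
      · exact (measurable_subtype_coe.pow_const _).real_toNNReal

end Spherical

theorem stmt_6 (n : ℕ) (hodd : Odd n) (hpos : 0 < n) (d : ℤ)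
    (q : EuclideanSpace ℝ (Fin n) → ℂ)
    (hsmooth : ContDiffOn ℝ (⊤ : ℕ∞) q {(0 : EuclideanSpace ℝ (Fin n))}ᶜ)
    (hhom : ∀ t : ℝ, 0 < t → ∀ ξ : EuclideanSpace ℝ (Fin n), ξ ≠ 0 →
      q (t • ξ) = (t : ℂ) ^ d * q ξ)
    (hpar : ∀ ξ : EuclideanSpace ℝ (Fin n), ξ ≠ 0 → q (-ξ) = (-1 : ℂ) ^ d * q ξ)
    (f : SchwartzMap (EuclideanSpace ℝ (Fin n)) ℂ) :
    ∃ F : ℂ → ℂ,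
      AnalyticOnNhd ℂ F
        ({z : ℂ | -(n : ℝ) - (d : ℝ) < z.re} ∪ {z : ℂ | ¬∃ m : ℤ, Odd m ∧ z = (m : ℂ)}) ∧
      ∀ z : ℂ, -(n : ℝ) - (d : ℝ) < z.re →
        Integrable (fun ξ => q ξ * Complex.exp (z * (Real.log ‖ξ‖ : ℂ)) * f ξ) ∧
        F z = ∫ ξ, q ξ * Complex.exp (z * (Real.log ‖ξ‖ : ℂ)) * f ξ := by
  have : Nonempty (Fin n) := ⟨⟨0, hpos⟩⟩
  have hdim : Module.finrank ℝ (EuclideanSpace ℝ (Fin n)) = n := by simp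
  have hq := hsmooth.continuousOn
  obtain ⟨F, hF, hF'⟩ := exists_analyticOnNhd_eq_mellin
    (hasDerivAt_sphericalIntegral volume hq f) (sphericalIntegral_isBigO volume hq f) d
    fun k hk ↦ sphericalIntegral_zero_of_odd volume hpar f hk
  refine ⟨fun z ↦ F (n + d + z), fun z hz ↦ ?_, fun z hz ↦ ?_⟩
  · refine (hF _ ?_).comp (by fun_prop)
    rcases hz with hz | hz
    · left
      simp only [mem_ofPred_eq] at hz
      simp only [Complex.add_re, Complex.natCast_re, Complex.intCast_re]
      linarith
    · refine .inr fun k hk h ↦ hz ⟨-(n + (d + k)), ?_, ?_⟩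
      · exact (((Int.odd_coe_nat n).2 hodd).add_even hk).neg
      · push_cast
        linear_combination h
  · have hz' : 0 < (Module.finrank ℝ (EuclideanSpace ℝ (Fin n)) : ℝ) + d + z.re := by
      rw [hdim]; linarith
    refine ⟨integrable_homogeneous_mul_schwartz volume hq hhom f hz', ?_⟩
    rw [integral_homogeneous_mul_schwartz_eq_mellin volume hq hhom f hz', hdim]
    exact hF' _ (by rw [hdim] at hz'; simpa using hz')
end

section
/- Let n ≥ 1 be an integer, let j be a real number with j > −n, and let q : ℝⁿ∖{0} → ℂ be continuous with q(tξ) = t^j q(ξ) for all t > 0 and ξ ≠ 0. Let φ : ℝ → ℝ be a smooth, positive, even function with φ(r) = r for r > 1 and φ(r) = 1 for |r| < 1/2. Then the function z ↦ ∫_{ℝⁿ} q(ξ) φ(|ξ|)^z dξ, whose defining integral converges absolutely for Re z < −j−n, extends to a function F analytic on ℂ∖{−j−n} satisfying F(0) = 0. -/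
open MeasureTheory

open Set Metric Filter Topology

section PolarCoordinates

variable {E : Type*} [NormedAddCommGroup E] [NormedSpace ℝ E] [MeasurableSpace E]
  [BorelSpace E] [FiniteDimensional ℝ E] [Nontrivial E]

/-- Integration in polar coordinates of a function that separates into an angular and a
radial factor. -/
lemma integrable_and_integral_of_polar_mul (μ : Measure E) [μ.IsAddHaarMeasure]
    {u : sphere (0 : E) 1 → ℂ} (hu : Integrable u μ.toSphere) {g : ℝ → ℂ}
    (hg : IntegrableOn (fun r : ℝ ↦ r ^ (Module.finrank ℝ E - 1) • g r) (Ioi 0)) {f : E → ℂ}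
    (hf : ∀ (s : sphere (0 : E) 1) (r : Ioi (0 : ℝ)), f (r.1 • s.1) = u s * g r) :
    Integrable f μ ∧ ∫ x, f x ∂μ =
      (∫ s, u s ∂μ.toSphere) * ∫ r in Ioi 0, r ^ (Module.finrank ℝ E - 1) • g r := by
  set d := Module.finrank ℝ E
  have hdens : Measurable fun r : Ioi (0 : ℝ) ↦ Real.toNNReal (r.1 ^ (d - 1)) :=
    (measurable_subtype_coe.pow_const _).real_toNNReal
  have hsmul {r : ℝ} (hr : 0 < r) :
      Real.toNNReal (r ^ (d - 1)) • g r = r ^ (d - 1) • g r := by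
    rw [NNReal.smul_def, Real.coe_toNNReal _ (pow_nonneg hr.le _)]
  have hgint : Integrable (fun r : Ioi (0 : ℝ) ↦ g r) (Measure.volumeIoiPow (d - 1)) := by
    rw [Measure.volumeIoiPow]
    simp only [ENNReal.ofReal]
    rw [integrable_withDensity_iff_integrable_smul hdens]
    rw [integrableOn_iff_comap_subtypeVal measurableSet_Ioi] at hg
    exact hg.congr (.of_forall fun r ↦ (hsmul r.2).symm)
  have hgval : ∫ r : Ioi (0 : ℝ), g r ∂Measure.volumeIoiPow (d - 1) =
      ∫ r in Ioi 0, r ^ (d - 1) • g r := by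
    simp only [Measure.volumeIoiPow, ENNReal.ofReal]
    rw [integral_withDensity_eq_integral_smul hdens,
      integral_subtype_comap measurableSet_Ioi fun a ↦ Real.toNNReal (a ^ (d - 1)) • g a]
    exact setIntegral_congr_fun measurableSet_Ioi fun r hr ↦ hsmul hr
  have hmp := μ.measurePreserving_homeomorphUnitSphereProd
  have hemb := (homeomorphUnitSphereProd E).measurableEmbedding
  let G : sphere (0 : E) 1 × Ioi (0 : ℝ) → ℂ := fun p ↦ u p.1 * g p.2
  have hfG (x : ({0}ᶜ : Set E)) : G (homeomorphUnitSphereProd E x) = f x := by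
    obtain ⟨⟨s, r⟩, rfl⟩ := (homeomorphUnitSphereProd E).symm.surjective x
    rw [(homeomorphUnitSphereProd E).apply_symm_apply]
    exact (hf s r).symm
  constructor
  · rw [← restrict_compl_singleton (μ := μ) 0, ← IntegrableOn,
      integrableOn_iff_comap_subtypeVal (by measurability)]
    exact ((hmp.integrable_comp_emb hemb).2 (hu.mul_prod hgint)).congr (.of_forall hfG)
  · have hsub := integral_subtype_comap (μ := μ) (measurableSet_singleton (0 : E)).compl f
    rw [restrict_compl_singleton] at hsub
    rw [← hgval, ← integral_prod_mul, ← hmp.integral_comp hemb, ← hsub]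
    exact integral_congr_ae (.of_forall fun x ↦ (hfG x).symm)

end PolarCoordinates

lemma integrable_mul_cexp_mul {α : Type*} [MeasurableSpace α] {μ : Measure α} {w : α → ℂ}
    (hw : Integrable w μ) {h : α → ℝ} (hh : AEStronglyMeasurable h μ) {M : ℝ}
    (hM : ∀ᵐ a ∂μ, |h a| ≤ M) (z : ℂ) :
    Integrable (fun a ↦ w a * Complex.exp (z * h a)) μ := by
  refine hw.mul_bdd (c := Real.exp (‖z‖ * M)) ?_ ?_
  · exact Complex.continuous_exp.comp_aestronglyMeasurable
      ((Complex.continuous_ofReal.comp_aestronglyMeasurable hh).const_mul z)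
  · filter_upwards [hM] with a ha
    refine (Complex.norm_exp_le_exp_norm _).trans (Real.exp_le_exp.2 ?_)
    rw [norm_mul, Complex.norm_real, Real.norm_eq_abs]
    gcongr

lemma differentiable_integral_mul_cexp_mul {α : Type*} [MeasurableSpace α] {μ : Measure α}
    {w : α → ℂ} (hw : Integrable w μ) {h : α → ℝ} (hh : AEStronglyMeasurable h μ) {M : ℝ}
    (hM : ∀ᵐ a ∂μ, |h a| ≤ M) :
    Differentiable ℂ fun z : ℂ ↦ ∫ a, w a * Complex.exp (z * h a) ∂μ := by
  intro z₀
  have hint := integrable_mul_cexp_mul hw hh hM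
  refine (hasDerivAt_integral_of_dominated_loc_of_deriv_le
    (F' := fun z a ↦ w a * Complex.exp (z * h a) * h a)
    (bound := fun a ↦ ‖w a‖ * (Real.exp ((‖z₀‖ + 1) * M) * M))
    (ball_mem_nhds z₀ one_pos) (.of_forall fun z ↦ (hint z).1) (hint z₀)
    ((hint z₀).1.mul (Complex.continuous_ofReal.comp_aestronglyMeasurable hh)) ?_
    (hw.norm.mul_const _) ?_).2.differentiableAt
  · filter_upwards [hM] with a ha z hz
    have hz' : ‖z‖ ≤ ‖z₀‖ + 1 := by
      have := norm_le_norm_add_norm_sub' z z₀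
      rw [mem_ball_iff_norm] at hz
      linarith
    rw [norm_mul, norm_mul, Complex.norm_real, Real.norm_eq_abs, mul_assoc]
    gcongr
    refine (Complex.norm_exp_le_exp_norm _).trans (Real.exp_le_exp.2 ?_)
    rw [norm_mul, Complex.norm_real, Real.norm_eq_abs]
    gcongr
  · refine .of_forall fun a z _ ↦ ?_
    have := (((hasDerivAt_id z).mul_const (h a : ℂ)).cexp).const_mul (w a)
    simpa [mul_assoc] using this

lemma integrableOn_and_integral_Ioi_rpow_mul_cexp_log {a : ℝ} {z : ℂ} (hz : z.re < -a) :
    IntegrableOn (fun r : ℝ ↦ ((r ^ (a - 1) : ℝ) : ℂ) * Complex.exp (z * Real.log r)) (Ioi 1) ∧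
    ∫ r in Ioi (1 : ℝ), ((r ^ (a - 1) : ℝ) : ℂ) * Complex.exp (z * Real.log r) =
      -1 / (z + a) := by
  have heq : EqOn (fun r : ℝ ↦ (r : ℂ) ^ (z + a - 1))
      (fun r : ℝ ↦ ((r ^ (a - 1) : ℝ) : ℂ) * Complex.exp (z * Real.log r)) (Ioi 1) := by
    intro r hr
    have hr0 : (0 : ℝ) < r := one_pos.trans hr
    have hrc : (r : ℂ) ≠ 0 := Complex.ofReal_ne_zero.2 hr0.ne'
    dsimp only
    rw [Complex.ofReal_cpow hr0.le, Complex.cpow_def_of_ne_zero hrc,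
      Complex.cpow_def_of_ne_zero hrc, Complex.ofReal_log hr0.le, ← Complex.exp_add]
    congr 1
    push_cast
    ring
  have hre : (z + a - 1).re < -1 := by
    simp only [Complex.sub_re, Complex.add_re, Complex.ofReal_re, Complex.one_re]
    linarith
  refine ⟨(integrableOn_Ioi_cpow_of_lt hre one_pos).congr_fun heq measurableSet_Ioi, ?_⟩
  rw [← setIntegral_congr_fun measurableSet_Ioi heq, integral_Ioi_cpow_of_lt hre one_pos]
  simp

theorem stmt_8 (n : ℕ) (hn : 1 ≤ n) (j : ℝ) (hj : -(n : ℝ) < j)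
    (q : EuclideanSpace ℝ (Fin n) → ℂ)
    (hcont : ContinuousOn q {(0 : EuclideanSpace ℝ (Fin n))}ᶜ)
    (hhom : ∀ t : ℝ, 0 < t → ∀ ξ : EuclideanSpace ℝ (Fin n), ξ ≠ 0 →
      q (t • ξ) = ((t ^ j : ℝ) : ℂ) * q ξ)
    (φ : ℝ → ℝ) (hφsmooth : ContDiff ℝ (⊤ : ℕ∞) φ) (hφpos : ∀ r : ℝ, 0 < φ r)
    (hφeven : ∀ r : ℝ, φ (-r) = φ r)
    (hφ1 : ∀ r : ℝ, 1 < r → φ r = r)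
    (hφ2 : ∀ r : ℝ, |r| < 1 / 2 → φ r = 1) :
    ∃ F : ℂ → ℂ,
      AnalyticOnNhd ℂ F {z : ℂ | z ≠ ((-j - (n : ℝ) : ℝ) : ℂ)} ∧
      (∀ z : ℂ, z.re < -j - (n : ℝ) →
        Integrable (fun ξ : EuclideanSpace ℝ (Fin n) =>
          q ξ * Complex.exp (z * (Real.log (φ ‖ξ‖) : ℂ))) ∧
        F z = ∫ ξ : EuclideanSpace ℝ (Fin n),
          q ξ * Complex.exp (z * (Real.log (φ ‖ξ‖) : ℂ))) ∧
      F 0 = 0 := by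
  have : Nonempty (Fin n) := ⟨⟨0, hn⟩⟩
  set a : ℝ := j + n with ha
  have ha0 : 0 < a := by linarith
  have hlog : Continuous fun r ↦ Real.log (φ r) :=
    hφsmooth.continuous.log fun r ↦ (hφpos r).ne'
  obtain ⟨M, hM⟩ := isCompact_Icc.exists_bound_of_continuousOn (s := Icc (0 : ℝ) 1)
    hlog.continuousOn
  have hM' : ∀ᵐ r ∂volume.restrict (Ioc (0 : ℝ) 1), |Real.log (φ r)| ≤ M := by
    filter_upwards [ae_restrict_mem measurableSet_Ioc] with r hr
    exact hM r (Ioc_subset_Icc_self hr)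
  have hw : IntegrableOn (fun r : ℝ ↦ ((r ^ (a - 1) : ℝ) : ℂ)) (Ioc 0 1) :=
    ((intervalIntegrable_iff_integrableOn_Ioc_of_le zero_le_one).1
      (intervalIntegral.intervalIntegrable_rpow' (by linarith : -1 < a - 1))).ofReal
  let H : ℂ → ℂ := fun z ↦
    ∫ r in Ioc (0 : ℝ) 1, ((r ^ (a - 1) : ℝ) : ℂ) * Complex.exp (z * Real.log (φ r))
  have hH : Differentiable ℂ H :=
    differentiable_integral_mul_cexp_mul hw hlog.aestronglyMeasurable hM'
  have hH0 : H 0 = 1 / a := by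
    simp only [H, zero_mul, Complex.exp_zero, mul_one]
    rw [integral_complex_ofReal, ← intervalIntegral.integral_of_le zero_le_one,
      integral_rpow (.inl (by linarith))]
    simp [ha0.ne']
  let C : ℂ := ∫ s : sphere (0 : EuclideanSpace ℝ (Fin n)) 1, q s ∂Measure.toSphere volume
  refine ⟨fun z ↦ C * (H z + -1 / (z + a)), ?_, fun z hz ↦ ?_, ?_⟩
  · refine DifferentiableOn.analyticOnNhd (fun z hz ↦ ?_) isOpen_ne
    have hza : z + a ≠ 0 := by
      intro h
      apply hz
      rw [eq_neg_of_add_eq_zero_left h, ha]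
      push_cast
      ring
    refine DifferentiableAt.differentiableWithinAt ?_
    exact ((hH z).add ((differentiableAt_const _).div
      (differentiableAt_id.add_const _) hza)).const_mul C
  · have hz' : z.re < -a := by linarith
    obtain ⟨hi, hv⟩ := integrableOn_and_integral_Ioi_rpow_mul_cexp_log hz'
    have hφIoi : EqOn (fun r : ℝ ↦ ((r ^ (a - 1) : ℝ) : ℂ) * Complex.exp (z * Real.log r))
        (fun r : ℝ ↦ ((r ^ (a - 1) : ℝ) : ℂ) * Complex.exp (z * Real.log (φ r))) (Ioi 1) := by
      intro r hr
      simp only [hφ1 r hr]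
    have hi' := hi.congr_fun hφIoi measurableSet_Ioi
    rw [setIntegral_congr_fun measurableSet_Ioi hφIoi] at hv
    have hi0 := integrable_mul_cexp_mul hw hlog.aestronglyMeasurable hM' z
    have hradial : EqOn
        (fun r : ℝ ↦ ((r ^ (a - 1) : ℝ) : ℂ) * Complex.exp (z * Real.log (φ r)))
        (fun r : ℝ ↦ r ^ (Module.finrank ℝ (EuclideanSpace ℝ (Fin n)) - 1) •
          (((r ^ j : ℝ) : ℂ) * Complex.exp (z * Real.log (φ r)))) (Ioi 0) := by
      intro r hr
      have : r ^ (a - 1) = r ^ (n - 1) * r ^ j := by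
        rw [← Real.rpow_natCast, ← Real.rpow_add hr, Nat.cast_sub hn, ha]
        congr 1
        push_cast
        ring
      simp only [finrank_euclideanSpace_fin, Complex.real_smul, this]
      push_cast
      ring
    have hu : Integrable (fun s : sphere (0 : EuclideanSpace ℝ (Fin n)) 1 ↦ q s)
        (Measure.toSphere volume) := by
      have hc : Continuous fun s : sphere (0 : EuclideanSpace ℝ (Fin n)) 1 ↦ q s :=
        hcont.comp_continuous continuous_subtype_val fun s ↦ ne_zero_of_mem_unit_sphere s
      exact hc.integrable_of_hasCompactSupport (.of_compactSpace _)
    have hIoi : IntegrableOn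
        (fun r : ℝ ↦ ((r ^ (a - 1) : ℝ) : ℂ) * Complex.exp (z * Real.log (φ r))) (Ioi 0) := by
      rw [← Ioc_union_Ioi_eq_Ioi zero_le_one]
      exact IntegrableOn.union hi0 hi'
    obtain ⟨hfi, hfv⟩ := integrable_and_integral_of_polar_mul volume hu
      (hIoi.congr_fun hradial measurableSet_Ioi)
      (f := fun ξ ↦ q ξ * Complex.exp (z * (Real.log (φ ‖ξ‖) : ℂ))) fun s r ↦ by
        have hr : (0 : ℝ) < r := r.2
        simp only [hhom r hr s (ne_zero_of_mem_unit_sphere s), norm_smul, norm_eq_of_mem_sphere,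
          Real.norm_eq_abs, abs_of_pos hr, mul_one]
        ring
    refine ⟨hfi, ?_⟩
    rw [hfv, ← setIntegral_congr_fun measurableSet_Ioi hradial,
      ← Ioc_union_Ioi_eq_Ioi zero_le_one,
      setIntegral_union (Ioc_disjoint_Ioi le_rfl) measurableSet_Ioi hi0 hi', hv]
  · simp only [hH0, zero_add]
    ring
end

section
/- Let H be a polynomial with real coefficients satisfying H(−x) = H(x) for all x, and let U = ℂ ∖ {−1, −3, −5, …} (the complement of the negative odd integers). Then there exists a function f analytic on U such that f(z) = Σ_{j=1}^∞ H(j) j^z for every z ∈ U with Re z < −deg H − 1 (the series converging absolutely there), and f(0) = −H(0)/2. -/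
open Polynomial in
theorem Polynomial.even_of_mem_support_of_eval_neg {H : ℝ[X]}
    (hH : ∀ x : ℝ, H.eval (-x) = H.eval x) {n : ℕ} (hn : n ∈ H.support) : Even n := by
  have hcomp : H.comp (C (-1) * X) = H := Polynomial.funext fun x => by simpa using hH x
  by_contra hodd
  have hc := congrArg (fun p => p.coeff n) hcomp
  simp only [comp_C_mul_X_coeff, (Nat.not_even_iff_odd.mp hodd).neg_one_pow] at hc
  exact mem_support_iff.mp hn (by linarith)

theorem hasSum_one_div_nat_add_one_cpow {s : ℂ} (hs : 1 < s.re) :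
    HasSum (fun j : ℕ => 1 / ((j : ℂ) + 1) ^ s) (riemannZeta s) := by
  rw [zeta_eq_tsum_one_div_nat_add_one_cpow hs]
  have h := (summable_nat_add_iff 1).mpr (Complex.summable_one_div_nat_cpow.mpr hs)
  exact Summable.hasSum (by simpa using h)

theorem one_div_nat_add_one_cpow_neg_sub (z : ℂ) (n j : ℕ) :
    1 / ((j : ℂ) + 1) ^ (-z - n) =
      ((j : ℂ) + 1) ^ n * Complex.exp (z * Real.log ((j : ℝ) + 1)) := by
  have hj : (j : ℂ) + 1 ≠ 0 := Nat.cast_add_one_ne_zero j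
  have hlog : ((Real.log ((j : ℝ) + 1) : ℝ) : ℂ) = Complex.log ((j : ℂ) + 1) := by
    rw [Complex.ofReal_log (by positivity)]
    push_cast
    rfl
  rw [one_div, ← Complex.cpow_neg, neg_sub, sub_neg_eq_add, Complex.cpow_add _ _ hj,
    Complex.cpow_natCast, Complex.cpow_def_of_ne_zero hj, hlog, mul_comm z]

theorem stmt_9 (H : Polynomial ℝ) (hH : ∀ x : ℝ, H.eval (-x) = H.eval x) :
    ∃ f : ℂ → ℂ,
      AnalyticOnNhd ℂ f {z : ℂ | ¬∃ m : ℕ, z = -(2 * (m : ℂ) + 1)} ∧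
      (∀ z ∈ {z : ℂ | ¬∃ m : ℕ, z = -(2 * (m : ℂ) + 1)},
        z.re < -(H.natDegree : ℝ) - 1 →
        HasSum (fun j : ℕ =>
          ((H.eval ((j : ℝ) + 1) : ℝ) : ℂ) * Complex.exp (z * Real.log ((j : ℝ) + 1))) (f z)) ∧
      f 0 = ((-H.eval 0 / 2 : ℝ) : ℂ) := by
  refine ⟨fun z => ∑ n ∈ H.support, (H.coeff n : ℂ) * riemannZeta (-z - n), ?_, ?_, ?_⟩
  · intro z hz
    refine Finset.analyticAt_fun_sum _ fun n hn => analyticAt_const.mul ?_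
    obtain ⟨m, rfl⟩ := (Polynomial.even_of_mem_support_of_eval_neg hH hn).two_dvd
    have hne : -z - ((2 * m : ℕ) : ℂ) ≠ 1 := fun h => hz ⟨m, by
      push_cast at h
      linear_combination -h⟩
    have hzeta : AnalyticAt ℂ riemannZeta (-z - ((2 * m : ℕ) : ℂ)) :=
      differentiableOn_riemannZeta.analyticAt (isOpen_compl_singleton.mem_nhds hne)
    exact hzeta.fun_comp (f := fun z : ℂ => -z - ((2 * m : ℕ) : ℂ)) (by fun_prop)
  · intro z _ hre
    have hsum : HasSum
        (fun j : ℕ => ∑ n ∈ H.support, (H.coeff n : ℂ) * (1 / ((j : ℂ) + 1) ^ (-z - n)))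
        (∑ n ∈ H.support, (H.coeff n : ℂ) * riemannZeta (-z - n)) := by
      refine hasSum_sum fun n hn => (hasSum_one_div_nat_add_one_cpow ?_).mul_left _
      have hle : (n : ℝ) ≤ H.natDegree := by
        exact_mod_cast Polynomial.le_natDegree_of_mem_supp n hn
      simp only [Complex.sub_re, Complex.neg_re, Complex.natCast_re]
      linarith
    convert hsum using 2 with j
    rw [Polynomial.eval_eq_sum, Polynomial.sum_def]
    push_cast
    rw [Finset.sum_mul]
    refine Finset.sum_congr rfl fun n _ => ?_
    rw [one_div_nat_add_one_cpow_neg_sub, mul_assoc]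
  · have hterm : ∀ n ∈ H.support, n ≠ 0 →
        (H.coeff n : ℂ) * riemannZeta (-0 - n) = 0 := by
      intro n hn hn0
      obtain ⟨m, rfl⟩ := (Polynomial.even_of_mem_support_of_eval_neg hH hn).two_dvd
      obtain ⟨k, rfl⟩ := Nat.exists_eq_succ_of_ne_zero (by lia : m ≠ 0)
      have harg : (-0 - ((2 * k.succ : ℕ) : ℂ)) = -2 * ((k : ℂ) + 1) := by
        push_cast
        ring
      rw [harg, riemannZeta_neg_two_mul_nat_add_one, mul_zero]
    dsimp only
    rw [Finset.sum_eq_single 0 hterm fun h0 => by simp [Polynomial.notMem_support_iff.mp h0],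
      ← Polynomial.coeff_zero_eq_eval_zero]
    simp only [neg_zero, Nat.cast_zero, sub_zero, riemannZeta_zero]
    push_cast
    ring
end

section
/- Define u : (0, π) → ℝ by u(r) = (r − π)² cos r/sin r. Then for every r ∈ (0, π), ( −3(r − π) cos r/(2 sin² r) + 3/(2 sin r) − (sin r)/2 )² = −(3/8)( u‴(r) − 2 u′(r) ) − 3/2 + (sin² r)/4, where u′, u‴ denote the first and third derivatives of u. -/
open Real

/-- A function agreeing on an open set with a differentiable function has the same derivative. -/
theorem deriv_eq_of_eqOn_isOpen {f g : ℝ → ℝ} {g' : ℝ} {s : Set ℝ} {x : ℝ} (hs : IsOpen s)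
    (hx : x ∈ s) (hfg : ∀ y ∈ s, f y = g y) (hg : HasDerivAt g g' x) : deriv f x = g' :=
  (hg.congr_of_eventuallyEq (Filter.eventually_of_mem (hs.mem_nhds hx) hfg)).deriv

theorem stmt_14 (u : ℝ → ℝ)
    (hu : ∀ r ∈ Set.Ioo (0 : ℝ) π, u r = (r - π) ^ 2 * Real.cos r / Real.sin r) :
    ∀ r ∈ Set.Ioo (0 : ℝ) π,
      (-3 * (r - π) * Real.cos r / (2 * Real.sin r ^ 2) + 3 / (2 * Real.sin r)
          - Real.sin r / 2) ^ 2 =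
        -(3 / 8) * (deriv (deriv (deriv u)) r - 2 * deriv u r) - 3 / 2
          + Real.sin r ^ 2 / 4 := by
  have hs : ∀ r ∈ Set.Ioo (0 : ℝ) π, sin r ≠ 0 := fun r hr =>
    (sin_pos_of_pos_of_lt_pi hr.1 hr.2).ne'
  have hx : ∀ r : ℝ, HasDerivAt (fun y => y - π) 1 r := fun r => (hasDerivAt_id r).sub_const π
  have h1 : ∀ r ∈ Set.Ioo (0 : ℝ) π,
      deriv u r = 2 * (r - π) * cos r / sin r - (r - π) ^ 2 / sin r ^ 2 := by
    intro r hr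
    have h0 := hs r hr
    refine deriv_eq_of_eqOn_isOpen isOpen_Ioo hr hu ?_
    refine HasDerivAt.congr_deriv ((((hx r).fun_pow 2).fun_mul (hasDerivAt_cos r)).fun_div (hasDerivAt_sin r) h0) ?_
    field_simp
    simp only [cos_sq']
    push_cast
    ring
  have h2 : ∀ r ∈ Set.Ioo (0 : ℝ) π,
      deriv (deriv u) r = 2 * cos r / sin r - 4 * (r - π) / sin r ^ 2
        + 2 * (r - π) ^ 2 * cos r / sin r ^ 3 := by
    intro r hr
    have h0 := hs r hr
    refine deriv_eq_of_eqOn_isOpen isOpen_Ioo hr h1 ?_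
    refine HasDerivAt.congr_deriv (((((hx r).const_mul 2).fun_mul (hasDerivAt_cos r)).fun_div (hasDerivAt_sin r) h0).fun_sub
      (((hx r).fun_pow 2).fun_div ((hasDerivAt_sin r).fun_pow 2) (pow_ne_zero 2 h0))) ?_
    field_simp
    simp only [cos_sq']
    push_cast
    ring
  have h3 : ∀ r ∈ Set.Ioo (0 : ℝ) π,
      deriv (deriv (deriv u)) r = -6 / sin r ^ 2 + 12 * (r - π) * cos r / sin r ^ 3
        - 2 * (r - π) ^ 2 / sin r ^ 2 - 6 * (r - π) ^ 2 * cos r ^ 2 / sin r ^ 4 := by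
    intro r hr
    have h0 := hs r hr
    refine deriv_eq_of_eqOn_isOpen isOpen_Ioo hr h2 ?_
    refine HasDerivAt.congr_deriv (((((hasDerivAt_cos r).const_mul 2).fun_div (hasDerivAt_sin r) h0).fun_sub
      (((hx r).const_mul 4).fun_div ((hasDerivAt_sin r).fun_pow 2) (pow_ne_zero 2 h0))).fun_add
      (((((hx r).fun_pow 2).const_mul 2).fun_mul (hasDerivAt_cos r)).fun_div
        ((hasDerivAt_sin r).fun_pow 3) (pow_ne_zero 3 h0))) ?_
    field_simp
    simp only [cos_sq']
    push_cast
    ring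
  intro r hr
  have h0 := hs r hr
  rw [h3 r hr, h1 r hr]
  field_simp
  ring
end
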